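/- arXiv:0811.1395 — 2 statements merged into one kernel-verified Lean document; each statement's English description precedes it below -/
import Mathlib

section
/- There exists a C*-algebra I of stable rank one whose multiplier algebra M(I) is not extremally rich. -/
open scoped MultiplierAlgebra

/-- A unital C*-algebra `A` is *extremally rich* if the set
`A⁻¹ 𝓔(A) A⁻¹ = {x * u * y : x, y invertible, u an extreme point of the closed unit ball}`
is dense in `A`. -/
def ExtremallyRich (A : Type*) [CStarAlgebra A] : Prop :=
  Dense {a : A | ∃ x u y : A, IsUnit x ∧ IsUnit y ∧
    u ∈ Set.extremePoints ℝ (Metric.closedBall (0 : A) 1) ∧ a = x * u * y}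

/-- A witness for Statement 17: a C*-algebra of stable rank one whose multiplier algebra is
not extremally rich. -/
structure Stmt17Witness : Type 1 where
  /-- The C*-algebra `I`. -/
  I : Type
  [instI : NonUnitalCStarAlgebra I]
  /-- `I` has stable rank one: the invertibles are dense in its minimal unitization. -/
  sr1 : Dense {x : Unitization ℂ I | IsUnit x}
  /-- The multiplier algebra `𝓜(ℂ, I)` is not extremally rich. -/
  notER : ¬ ExtremallyRich 𝓜(ℂ, I)

section Extreme

variable {A : Type*} [CStarAlgebra A]

/-- An extreme point of the closed unit ball of a C⋆-algebra is a partial isometry. -/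
lemma mul_one_sub_star_mul_self_of_mem_extremePoints {u : A}
    (hu : u ∈ Set.extremePoints ℝ (Metric.closedBall (0 : A) 1)) :
    u * (1 - star u * u) = 0 := by
  let _ := CStarAlgebra.spectralOrder A
  have _ := CStarAlgebra.spectralOrderedRing A
  rw [mem_extremePoints] at hu
  obtain ⟨hu1, hu2⟩ := hu
  rw [mem_closedBall_zero_iff] at hu1
  set t := 1 - star u * u with ht
  have hh : star u * u = 1 - t := by rw [ht]; abel
  have h1 : ‖star u * u‖ ≤ 1 := by
    rw [CStarRing.norm_star_mul_self]; nlinarith [norm_nonneg u]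
  have ht0 : 0 ≤ t :=
    sub_nonneg.2 ((CStarAlgebra.norm_le_one_iff_of_nonneg _ (star_mul_self_nonneg u)).1 h1)
  have hts : star t = t := (IsSelfAdjoint.of_nonneg ht0).star_eq
  have hminus : ‖u - (1 / 2 : ℝ) • (u * t)‖ ≤ 1 := by
    have e : u - (1 / 2 : ℝ) • (u * t) = (1 / 2 : ℝ) • (u + u * (star u * u)) := by
      rw [hh]; simp only [mul_sub, mul_one]; module
    have h2 : ‖u * (star u * u)‖ ≤ 1 :=
      (norm_mul_le _ _).trans (mul_le_one₀ hu1 (norm_nonneg _) h1)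
    rw [e, norm_smul]
    have := norm_add_le u (u * (star u * u))
    norm_num
    linarith
  have hplus : ‖u + (1 / 2 : ℝ) • (u * t)‖ ≤ 1 := by
    have e : star (u + (1 / 2 : ℝ) • (u * t)) * (u + (1 / 2 : ℝ) • (u * t)) =
        1 - ((3 / 4 : ℝ) • (star t * t) + (1 / 4 : ℝ) • (star t * t * t)) := by
      have : star (u + (1 / 2 : ℝ) • (u * t)) * (u + (1 / 2 : ℝ) • (u * t)) =
        (1 + (1 / 2 : ℝ) • t) * (star u * u) * (1 + (1 / 2 : ℝ) • t) := by
        simp only [star_add, star_smul, star_mul, hts, star_trivial]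
        simp only [add_mul, mul_add, smul_mul_assoc, mul_smul_comm, one_mul, mul_one, mul_assoc]
      rw [this, hh, hts]
      simp only [add_mul, mul_add, sub_mul, mul_sub, smul_mul_assoc, mul_smul_comm, one_mul,
        mul_one, mul_assoc]
      module
    have h3 : 0 ≤ star t * t * t := by
      have := star_left_conjugate_nonneg ht0 t
      simpa only [hts] using this
    have h4 : star (u + (1 / 2 : ℝ) • (u * t)) * (u + (1 / 2 : ℝ) • (u * t)) ≤ 1 := by
      rw [e]
      exact sub_le_self _ (add_nonneg (smul_nonneg (by norm_num) (star_mul_self_nonneg t))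
        (smul_nonneg (by norm_num) h3))
    have h5 := (CStarAlgebra.norm_le_one_iff_of_nonneg _ (star_mul_self_nonneg _)).2 h4
    rw [CStarRing.norm_star_mul_self] at h5
    nlinarith [norm_nonneg (u + (1 / 2 : ℝ) • (u * t))]
  have := (hu2 _ (mem_closedBall_zero_iff.2 hplus) _ (mem_closedBall_zero_iff.2 hminus)
    ⟨1 / 2, 1 / 2, by norm_num, by norm_num, by norm_num, by module⟩).1
  simpa using this

/-- For an extreme point `u` of the closed unit ball of a C⋆-algebra, the defect projections
`1 - u u⋆` and `1 - u⋆ u` are centrally orthogonal. -/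
lemma defect_mul_mul_defect_of_mem_extremePoints {u : A}
    (hu : u ∈ Set.extremePoints ℝ (Metric.closedBall (0 : A) 1)) (x : A) :
    (1 - u * star u) * x * (1 - star u * u) = 0 := by
  let _ := CStarAlgebra.spectralOrder A
  have _ := CStarAlgebra.spectralOrderedRing A
  have hut := mul_one_sub_star_mul_self_of_mem_extremePoints hu
  rw [mem_extremePoints] at hu
  set t := 1 - star u * u with ht
  have hts : star t = t := by simp [ht]
  have htt : t * t = t := by
    have : star u * (u * t) = 0 := by rw [hut, mul_zero]
    rw [← mul_assoc] at this
    nth_rw 1 [ht]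
    rw [sub_mul, one_mul, this, sub_zero]
  have hue : star u * (1 - u * star u) = 0 := by
    have := congr_arg star hut
    simp only [ht, star_mul, star_zero, star_sub, star_one, star_star] at this
    rw [← this]; noncomm_ring
  have key (y : A) (hy1 : ‖y‖ ≤ 1) (hy : star u * y = 0) (hyt : y * t = y) : ‖u + y‖ ≤ 1 := by
    have hy' : star y * u = 0 := by simpa using congr_arg star hy
    have hyy : star y * y ≤ t := by
      have h1 : star y * y ≤ 1 := by
        rw [← CStarAlgebra.norm_le_one_iff_of_nonneg _ (star_mul_self_nonneg _),
          CStarRing.norm_star_mul_self]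
        nlinarith [norm_nonneg y]
      have h2 := star_left_conjugate_le_conjugate h1 t
      have h3 : star t * (star y * y) * t = star y * y := by
        rw [mul_assoc, mul_assoc, hyt, ← mul_assoc, ← star_mul, hyt]
      rwa [h3, mul_one, hts, htt] at h2
    have h4 : star (u + y) * (u + y) ≤ 1 := by
      have : star (u + y) * (u + y) = star u * u + star y * y := by
        simp [add_mul, mul_add, hy, hy']
      rw [this]
      calc star u * u + star y * y ≤ star u * u + t := by gcongr
        _ = 1 := by rw [ht]; abel
    have h5 := (CStarAlgebra.norm_le_one_iff_of_nonneg _ (star_mul_self_nonneg _)).2 h4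
    rw [CStarRing.norm_star_mul_self] at h5
    nlinarith [norm_nonneg (u + y)]
  set z := (1 - u * star u) * x * t with hz
  obtain ⟨r, hr0, hr⟩ : ∃ r : ℝ, 0 < r ∧ ‖r • z‖ ≤ 1 := by
    refine ⟨(1 + ‖z‖)⁻¹, by positivity, ?_⟩
    rw [norm_smul, Real.norm_of_nonneg (by positivity), inv_mul_le_iff₀ (by positivity)]
    linarith
  have hz1 : star u * z = 0 := by rw [hz, ← mul_assoc, ← mul_assoc, hue]; simp
  have hz2 : z * t = z := by rw [hz, mul_assoc, htt]
  have hplus := key (r • z) hr (by rw [mul_smul_comm, hz1, smul_zero])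
    (by rw [smul_mul_assoc, hz2])
  have hminus := key (-(r • z)) (by rwa [norm_neg]) (by rw [mul_neg, mul_smul_comm, hz1]; simp)
    (by rw [neg_mul, smul_mul_assoc, hz2])
  have := (hu.2 _ (mem_closedBall_zero_iff.2 hplus) _ (mem_closedBall_zero_iff.2 hminus)
    ⟨1 / 2, 1 / 2, by norm_num, by norm_num, by norm_num, by module⟩).1
  simpa [hr0.ne'] using this

end Extreme

section Corner

open InnerProductSpace

variable {H : Type*} [NormedAddCommGroup H] [InnerProductSpace ℂ H] 

/-- The compression of an operator to a subspace, as a linear endomorphism. -/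
noncomputable def compression (V : Submodule ℂ H) [V.HasOrthogonalProjection] :
    (H →L[ℂ] H) →ₗ[ℂ] Module.End ℂ V where
  toFun x := (V.orthogonalProjectionOnto ∘L x ∘L V.subtypeL : V →L[ℂ] V)
  map_add' x y := by ext; simp
  map_smul' c x := by ext; simp

variable {V : Submodule ℂ H} [V.HasOrthogonalProjection] 

lemma eq_of_compression_eq {x y : H →L[ℂ] H}
    (hx1 : V.starProjection * x = x) (hx2 : x * V.starProjection = x)
    (hy1 : V.starProjection * y = y) (hy2 : y * V.starProjection = y)
    (h : compression V x = compression V y) : x = y := by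
  have key (z : H →L[ℂ] H) (hz1 : V.starProjection * z = z) (hz2 : z * V.starProjection = z)
      (ξ : H) : z ξ = (compression V z (V.orthogonalProjectionOnto ξ) : H) := by
    conv_lhs => rw [← hz2, ← hz1]
    rfl
  ext ξ
  rw [key x hx1 hx2, key y hy1 hy2, h]

lemma compression_mul {x y : H →L[ℂ] H} (hy : V.starProjection * y = y) :
    compression V (x * y) = compression V x * compression V y := by
  ext ξ
  conv_lhs => rw [← hy]
  rfl

lemma compression_starProjection : compression V V.starProjection = 1 := by
  ext ξ
  simp [compression]

/-- A corner of finite rank is Dedekind finite. -/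
lemma corner_mul_eq_starProjection_comm [FiniteDimensional ℂ V] {a b : H →L[ℂ] H}
    (ha1 : V.starProjection * a = a) (ha2 : a * V.starProjection = a)
    (hb1 : V.starProjection * b = b)
    (h : a * b = V.starProjection) : b * a = V.starProjection := by
  have hp : V.starProjection * V.starProjection = V.starProjection :=
    V.isIdempotentElem_starProjection
  refine eq_of_compression_eq (V := V) (by rw [← mul_assoc, hb1]) (by rw [mul_assoc, ha2]) hp hp ?_
  rw [compression_mul ha1, compression_starProjection, _root_.mul_eq_one_comm,
    ← compression_mul hb1, h, compression_starProjection]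

/-- If `E B(H) F = 0`, then one of `E`, `F` vanishes; version for a corner of `B(H)`. -/
lemma eq_zero_or_eq_zero_of_corner_mul {E F : H →L[ℂ] H}
    (hE : E * V.starProjection = E) (hF : V.starProjection * F = F)
    (h : ∀ c : H →L[ℂ] H, V.starProjection * c = c → c * V.starProjection = c → E * c * F = 0) :
    E = 0 ∨ F = 0 := by
  have hp : V.starProjection * V.starProjection = V.starProjection :=
    V.isIdempotentElem_starProjection
  by_contra! hne
  obtain ⟨hE0, hF0⟩ := hne
  obtain ⟨ξ, hξ⟩ : ∃ ξ, F ξ ≠ 0 := by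
    by_contra! h0; exact hF0 (ContinuousLinearMap.ext h0)
  obtain ⟨η, hη⟩ : ∃ η, E η ≠ 0 := by
    by_contra! h0; exact hE0 (ContinuousLinearMap.ext h0)
  have h1 := h (V.starProjection * rankOne ℂ η (F ξ) * V.starProjection)
    (by rw [← mul_assoc, ← mul_assoc, hp]) (by rw [mul_assoc, hp])
  have h2 : E * rankOne ℂ η (F ξ) * F = 0 := by
    rw [← h1]; simp only [← mul_assoc, hE]; simp only [mul_assoc, hF]
  have h3 := congr_arg (fun T : H →L[ℂ] H ↦ T ξ) h2
  simp [hξ, hη] at h3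

variable [CompleteSpace H]

/-- In a finite-rank corner of `B(H)`, an element with centrally orthogonal defects is unitary. -/
lemma corner_unitary_of_defect_mul_defect [FiniteDimensional ℂ V] {v : H →L[ℂ] H}
    (hv1 : V.starProjection * v = v) (hv2 : v * V.starProjection = v)
    (h : ∀ c : H →L[ℂ] H, V.starProjection * c = c → c * V.starProjection = c →
      (V.starProjection - v * star v) * c * (V.starProjection - star v * v) = 0) :
    star v * v = V.starProjection ∧ v * star v = V.starProjection := by
  have hp : V.starProjection * V.starProjection = V.starProjection :=
    V.isIdempotentElem_starProjection
  have hps : star V.starProjection = V.starProjection :=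
    isSelfAdjoint_starProjection V
  have hs1 : V.starProjection * star v = star v := by
    simpa [hps] using congr_arg star hv2
  have hs2 : star v * V.starProjection = star v := by
    simpa [hps] using congr_arg star hv1
  rcases eq_zero_or_eq_zero_of_corner_mul
      (by rw [sub_mul, hp, mul_assoc, hs2]) (by rw [mul_sub, hp, ← mul_assoc, hs1]) h with h0 | h0
  · have := (sub_eq_zero.1 h0).symm
    exact ⟨corner_mul_eq_starProjection_comm hv1 hv2 hs1 this, this⟩
  · have := (sub_eq_zero.1 h0).symm
    exact ⟨this, corner_mul_eq_starProjection_comm hs1 hs2 hv1 this⟩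

end Corner

section DoubleCentralizer

variable {A : Type*} [NonUnitalCStarAlgebra A]

lemma DoubleCentralizer.fst_mul_apply (m : 𝓜(ℂ, A)) (a b : A) :
    m.fst (a * b) = m.fst a * b := by
  have key (c : A) : c * (m.fst (a * b) - m.fst a * b) = 0 := by
    rw [mul_sub, ← m.central, ← mul_assoc c, ← m.central, mul_assoc, sub_self]
  exact sub_eq_zero.1 (CStarRing.star_mul_self_eq_zero_iff _ |>.1 (key _))

lemma DoubleCentralizer.ext_fst {m m' : 𝓜(ℂ, A)} (h : ∀ a, m.fst a = m'.fst a) : m = m' := by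
  have h2 (b : A) : m.snd b = m'.snd b := by
    have key (a : A) : (m.snd b - m'.snd b) * a = 0 := by
      rw [sub_mul, m.central, m'.central, h, sub_self]
    exact sub_eq_zero.1 (CStarRing.mul_star_self_eq_zero_iff _ |>.1 (key _))
  exact DoubleCentralizer.ext _ _ _ _ (Prod.ext (ContinuousLinearMap.ext h)
    (ContinuousLinearMap.ext h2))

end DoubleCentralizer

section CornerSequences

open Filter Topology OnePoint InnerProductSpace

variable {H : Type} [NormedAddCommGroup H] [InnerProductSpace ℂ H] [CompleteSpace H]
variable (V : ℕ → Submodule ℂ H) [∀ n, FiniteDimensional ℂ (V n)]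

/-- The C⋆-algebra of norm convergent sequences `a` of operators on `H` such that `a n` belongs to
the corner of `B(H)` given by the finite-dimensional subspace `V n`. -/
noncomputable def cornerSubalgebra : NonUnitalStarSubalgebra ℂ C(OnePoint ℕ, H →L[ℂ] H) where
  carrier := {a | ∀ n : ℕ, (V n).starProjection * a n = a n ∧ a n * (V n).starProjection = a n}
  add_mem' ha hb n := by simp [mul_add, add_mul, ha n, hb n]
  zero_mem' n := by simp
  mul_mem' {a b} ha hb n :=
    ⟨by rw [ContinuousMap.mul_apply, ← mul_assoc, (ha n).1],
      by rw [ContinuousMap.mul_apply, mul_assoc, (hb n).2]⟩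
  smul_mem' c a ha n := by simp [ha n]
  star_mem' {a} ha n := by
    have hps : star (V n).starProjection = (V n).starProjection := isSelfAdjoint_starProjection _
    exact ⟨by simpa [hps] using congr_arg star (ha n).2,
      by simpa [hps] using congr_arg star (ha n).1⟩

instance isClosed_cornerSubalgebra :
    IsClosed (cornerSubalgebra V : Set C(OnePoint ℕ, H →L[ℂ] H)) := by
  have : (cornerSubalgebra V : Set C(OnePoint ℕ, H →L[ℂ] H)) =
      ⋂ n : ℕ, {a | (V n).starProjection * a n = a n} ∩ {a | a n * (V n).starProjection = a n} := by
    ext a; simp only [Set.mem_iInter]; rfl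
  rw [this]
  refine isClosed_iInter fun n ↦ IsClosed.inter ?_ ?_ <;>
    exact isClosed_eq (by fun_prop) (by fun_prop)

/-- The C⋆-algebra of norm convergent sequences in the corners `V n`, as a type. -/
noncomputable def CornerSequences : Type := cornerSubalgebra V

noncomputable instance : NonUnitalCStarAlgebra (CornerSequences V) :=
  inferInstanceAs (NonUnitalCStarAlgebra (cornerSubalgebra V))

variable {V}

namespace CornerSequences

noncomputable instance : CoeFun (CornerSequences V) fun _ ↦ OnePoint ℕ → H →L[ℂ] H := ⟨fun a ↦ a.1⟩

@[simp] lemma zero_apply (x : OnePoint ℕ) : (0 : CornerSequences V) x = 0 := rfl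

@[simp] lemma add_apply (a b : CornerSequences V) (x : OnePoint ℕ) : (a + b) x = a x + b x := rfl

@[simp] lemma sub_apply (a b : CornerSequences V) (x : OnePoint ℕ) : (a - b) x = a x - b x := rfl

@[simp] lemma smul_apply (c : ℂ) (a : CornerSequences V) (x : OnePoint ℕ) :
    (c • a) x = c • a x := rfl

@[simp] lemma mul_apply (a b : CornerSequences V) (x : OnePoint ℕ) : (a * b) x = a x * b x := rfl

@[simp] lemma star_apply (a : CornerSequences V) (x : OnePoint ℕ) : star a x = star (a x) := rfl

lemma proj_mul (a : CornerSequences V) (n : ℕ) : (V n).starProjection * a n = a n :=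
  (a.2 n).1

lemma mul_proj (a : CornerSequences V) (n : ℕ) : a n * (V n).starProjection = a n :=
  (a.2 n).2

lemma tendsto (a : CornerSequences V) : Tendsto (fun n : ℕ ↦ a n) atTop (𝓝 (a ∞)) :=
  (OnePoint.continuous_iff_from_nat _).1 a.1.continuous

lemma ext_of_nat {a b : CornerSequences V} (h : ∀ n : ℕ, a n = b n) : a = b := by
  refine Subtype.ext (ContinuousMap.ext fun x ↦ ?_)
  induction x using OnePoint.rec with
  | coe n => exact h n
  | infty => exact tendsto_nhds_unique (tendsto a) ((tendsto b).congr fun n ↦ (h n).symm)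

lemma norm_apply_le (a : CornerSequences V) (x : OnePoint ℕ) : ‖a x‖ ≤ ‖a‖ :=
  a.1.norm_coe_le_norm x

lemma norm_le_of_nat {a : CornerSequences V} {C : ℝ} (h : ∀ n : ℕ, ‖a n‖ ≤ C) : ‖a‖ ≤ C := by
  refine (ContinuousMap.norm_le _ ((norm_nonneg _).trans (h 0))).2 fun x ↦ ?_
  induction x using OnePoint.rec with
  | coe n => exact h n
  | infty => exact le_of_tendsto (tendsto a).norm (Eventually.of_forall h)

/-- The element of `CornerSequences V` given by a convergent sequence in the corners. -/
noncomputable def mk (f : ℕ → H →L[ℂ] H) (l : H →L[ℂ] H) (h : Tendsto f atTop (𝓝 l))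
    (hf : ∀ n, (V n).starProjection * f n = f n ∧ f n * (V n).starProjection = f n) :
    CornerSequences V :=
  ⟨OnePoint.continuousMapMkNat f l h, hf⟩

@[simp] lemma mk_apply {f : ℕ → H →L[ℂ] H} {l h} (hf) (n : ℕ) :
    mk (V := V) f l h hf n = f n := rfl

@[simp] lemma mk_infty {f : ℕ → H →L[ℂ] H} {l h} (hf) :
    mk (V := V) f l h hf ∞ = l := rfl

/-- The sequence with value `c` at `n` and zero elsewhere. -/
noncomputable def single (n : ℕ) (c : H →L[ℂ] H) (h1 : (V n).starProjection * c = c)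
    (h2 : c * (V n).starProjection = c) : CornerSequences V :=
  mk (Pi.single n c) 0
    (tendsto_const_nhds.congr' <| (eventually_gt_atTop n).mono fun k hk ↦ by simp [hk.ne'])
    fun k ↦ by
      rcases eq_or_ne k n with rfl | hk
      · simp [h1, h2]
      · simp [hk]

@[simp] lemma single_apply_self {n : ℕ} {c : H →L[ℂ] H} (h1 h2) :
    single (V := V) n c h1 h2 n = c := by
  simp [single]

/-- The central projection of `CornerSequences V` supported at `n`. -/
noncomputable def unitAt (V : ℕ → Submodule ℂ H) [∀ n, FiniteDimensional ℂ (V n)] (n : ℕ) :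
    CornerSequences V :=
  single n (V n).starProjection (V n).isIdempotentElem_starProjection
    (V n).isIdempotentElem_starProjection

end CornerSequences

end CornerSequences

/-! ### Stable rank one -/

section Integral

lemma spectrum_finite_of_isIntegral {𝕜 A : Type*} [Field 𝕜] [Ring A] [Algebra 𝕜 A] {a : A}
    (ha : IsIntegral 𝕜 a) : (spectrum 𝕜 a).Finite := by
  nontriviality A
  refine ((minpoly 𝕜 a).rootSet_finite 𝕜).subset fun r hr ↦ ?_
  have h := spectrum.subset_polynomial_aeval a (minpoly 𝕜 a) ⟨r, hr, rfl⟩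
  rw [minpoly.aeval, spectrum.zero_eq] at h
  rw [Polynomial.mem_rootSet]
  exact ⟨minpoly.ne_zero ha, by simpa using h⟩

lemma isIntegral_inr_of_mem {𝕜 A : Type*} [Field 𝕜] [NonUnitalRing A] [Module 𝕜 A]
    [IsScalarTower 𝕜 A A] [SMulCommClass 𝕜 A A] (S : NonUnitalSubalgebra 𝕜 A)
    {W : Type*} [AddCommGroup W] [Module 𝕜 W] [FiniteDimensional 𝕜 W] (F : A →ₗ[𝕜] W)
    (hF : ∀ a ∈ S, F a = 0 → a = 0) {b : A} (hb : b ∈ S) :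
    IsIntegral 𝕜 (b : Unitization 𝕜 A) := by
  have : Module.Finite 𝕜 S :=
    Module.Finite.of_injective (F ∘ₗ S.toSubmodule.subtype) <|
      (injective_iff_map_eq_zero _).2 fun a ha ↦ Subtype.ext (hF a a.2 ha)
  have : Module.Finite 𝕜 (Unitization 𝕜 S) := 
    Module.Finite.equiv (Unitization.linearEquiv 𝕜 𝕜 S).symm
  have h1 : IsIntegral 𝕜 ((⟨b, hb⟩ : S) : Unitization 𝕜 S) := Algebra.IsIntegral.isIntegral _
  have := h1.map (Unitization.lift ((Unitization.inrNonUnitalAlgHom 𝕜 A).comp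
    (NonUnitalSubalgebraClass.subtype S)))
  simpa using this

/-- A non-unital C⋆-algebra in which the elements that are algebraic over `ℂ` are dense has
stable rank one. -/
lemma dense_isUnit_unitization_of_isIntegral {A : Type*} [NonUnitalCStarAlgebra A]
    (h : ∀ (a : A) (ε : ℝ), 0 < ε → ∃ b : A, IsIntegral ℂ (b : Unitization ℂ A) ∧ ‖a - b‖ < ε) :
    Dense {x : Unitization ℂ A | IsUnit x} := by
  refine Metric.dense_iff.2 fun x ε hε ↦ ?_
  obtain ⟨b, hb, hab⟩ := h x.snd (ε / 2) (half_pos hε)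
  have hfin := spectrum_finite_of_isIntegral hb.neg
  obtain ⟨r, hr1, hr2⟩ : ∃ r ∈ Metric.ball x.fst (ε / 2),
      r ∉ spectrum ℂ (-(b : Unitization ℂ A)) := by
    obtain ⟨r, hr, hrs⟩ := (hfin.countable.dense_compl ℂ).exists_mem_open Metric.isOpen_ball
      ⟨x.fst, Metric.mem_ball_self (half_pos hε)⟩
    exact ⟨r, hrs, hr⟩
  refine ⟨algebraMap ℂ _ r + (b : Unitization ℂ A), ?_, ?_⟩
  · rw [mem_ball_iff_norm]
    have e : algebraMap ℂ _ r + (b : Unitization ℂ A) - x =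
        algebraMap ℂ _ (r - x.fst) - ((x.snd - b : A) : Unitization ℂ A) := by
      nth_rw 1 [← Unitization.inl_fst_add_inr_snd_eq x]
      simp only [Unitization.algebraMap_eq_inl, Unitization.inl_sub, Unitization.inr_sub]
      abel
    rw [e]
    refine (norm_sub_le _ _).trans_lt ?_
    rw [norm_algebraMap', Unitization.norm_inr]
    rw [mem_ball_iff_norm] at hr1
    linarith
  · have := spectrum.notMem_iff.1 hr2
    simpa using this

end Integral

section CornerSequences
open Filter Topology OnePoint InnerProductSpace

variable {H : Type} [NormedAddCommGroup H] [InnerProductSpace ℂ H] [CompleteSpace H]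
variable {V : ℕ → Submodule ℂ H} [∀ n, FiniteDimensional ℂ (V n)]

namespace CornerSequences

/-- The elements of `CornerSequences V` that are constant from `N` on. -/
noncomputable def eventuallyConst (V : ℕ → Submodule ℂ H) [∀ n, FiniteDimensional ℂ (V n)]
    (N : ℕ) : NonUnitalSubalgebra ℂ (CornerSequences V) where
  carrier := {a | ∀ n : ℕ, N ≤ n → a n = a N}
  add_mem' {a b} ha hb n hn := by simp [ha n hn, hb n hn]
  zero_mem' n _ := rfl
  mul_mem' {a b} ha hb n hn := by simp [ha n hn, hb n hn]
  smul_mem' c a ha n hn := by simp [ha n hn]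

/-- The first `N + 1` entries of an element of `CornerSequences V`. -/
noncomputable def restrict (V : ℕ → Submodule ℂ H) [∀ n, FiniteDimensional ℂ (V n)] (N : ℕ) :
    CornerSequences V →ₗ[ℂ] ∀ i : Fin (N + 1), Module.End ℂ (V i) where
  toFun a i := compression (V i) (a (i : ℕ))
  map_add' a b := by ext1; simp
  map_smul' c a := by ext1; simp

lemma eq_zero_of_restrict_eq_zero {N : ℕ} {a : CornerSequences V} (ha : a ∈ eventuallyConst V N)
    (h : restrict V N a = 0) : a = 0 := by
  have key (k : ℕ) (hk : k ≤ N) : a k = 0 :=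
    eq_of_compression_eq (proj_mul a k) (mul_proj a k) (mul_zero _) (zero_mul _)
      ((congr_fun h ⟨k, Nat.lt_succ_of_le hk⟩).trans (map_zero _).symm)
  refine ext_of_nat fun n ↦ ?_
  rcases le_total n N with hn | hn
  · exact key n hn
  · rw [ha n hn, key N le_rfl]; rfl

lemma exists_mem_eventuallyConst_norm_sub_lt (hV : Monotone V) (a : CornerSequences V) {ε : ℝ}
    (hε : 0 < ε) : ∃ N, ∃ b ∈ eventuallyConst V N, ‖a - b‖ < ε := by
  obtain ⟨N, hN⟩ := Metric.cauchySeq_iff'.1 (tendsto a).cauchySeq (ε / 2) (half_pos hε)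
  refine ⟨N, mk (fun n ↦ a (min n N : ℕ)) (a N) ?_ fun n ↦ ?_, fun n hn ↦ ?_, ?_⟩
  · exact tendsto_const_nhds.congr' <| (eventually_ge_atTop N).mono fun n hn ↦ by
      simp [min_eq_right hn]
  · have hle : V (min n N) ≤ V n := hV (min_le_left _ _)
    have h1 : (V (min n N)).starProjection * (V n).starProjection =
        (V (min n N)).starProjection := Submodule.starProjection_comp_starProjection_of_le hle
    have h2 : (V n).starProjection * (V (min n N)).starProjection =
        (V (min n N)).starProjection := by
      have hps (k) : star (V k).starProjection = (V k).starProjection :=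
        isSelfAdjoint_starProjection _
      simpa [hps] using congr_arg star h1
    constructor
    · rw [← proj_mul a (min n N), ← mul_assoc, h2]
    · rw [← mul_proj a (min n N), mul_assoc, h1]
  · simp [min_eq_right hn]
  · refine (norm_le_of_nat (C := ε / 2) fun n ↦ ?_).trans_lt (half_lt_self hε)
    rcases le_total n N with hn | hn
    · simp [min_eq_left hn, (half_pos hε).le]
    · have := (hN n hn).le
      rw [dist_eq_norm] at this
      simpa [min_eq_right hn] using this


lemma isIntegral_inr {N : ℕ} {a : CornerSequences V} (ha : a ∈ eventuallyConst V N) :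
    IsIntegral ℂ (a : Unitization ℂ (CornerSequences V)) :=
  isIntegral_inr_of_mem (eventuallyConst V N) (restrict V N)
    (fun _ ↦ eq_zero_of_restrict_eq_zero) ha

lemma dense_isUnit (hV : Monotone V) :
    Dense {x : Unitization ℂ (CornerSequences V) | IsUnit x} := by
  refine dense_isUnit_unitization_of_isIntegral fun a _ hε ↦ ?_
  obtain ⟨N, b, hb, hab⟩ := exists_mem_eventuallyConst_norm_sub_lt hV a hε
  exact ⟨b, isIntegral_inr hb, hab⟩

end CornerSequences

end CornerSequences

/-! ### Components of a multiplier -/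

section Locality

open Filter Topology OnePoint InnerProductSpace

variable {H : Type} [NormedAddCommGroup H] [InnerProductSpace ℂ H] [CompleteSpace H]
variable {V : ℕ → Submodule ℂ H} [∀ n, FiniteDimensional ℂ (V n)]

namespace CornerSequences

/-- Multipliers act locally. -/
lemma fst_apply_eq_zero (m : 𝓜(ℂ, CornerSequences V)) {a : CornerSequences V} {x : OnePoint ℕ}
    (h : a x = 0) : m.fst a x = 0 := by
  have key : star (m.fst a) * m.fst a = m.snd (star (m.fst a)) * a := (m.central _ _).symm
  have key' : star (m.fst a x) * m.fst a x = 0 := by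
    rw [← star_apply, ← mul_apply, key, mul_apply, h, mul_zero]
  exact (CStarRing.star_mul_self_eq_zero_iff _).1 key'

lemma fst_apply_congr (m : 𝓜(ℂ, CornerSequences V)) {a b : CornerSequences V} {x : OnePoint ℕ}
    (h : a x = b x) : m.fst a x = m.fst b x := by
  have := fst_apply_eq_zero m (a := a - b) (x := x) (by simp [h])
  rwa [map_sub, sub_apply, sub_eq_zero] at this

@[simp] lemma unitAt_apply_self (n : ℕ) : unitAt V n n = (V n).starProjection :=
  single_apply_self _ _

/-- The component at `n` of a multiplier. -/
noncomputable def evalAt (n : ℕ) (m : 𝓜(ℂ, CornerSequences V)) : H →L[ℂ] H :=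
  m.fst (unitAt V n) n

lemma fst_apply (m : 𝓜(ℂ, CornerSequences V)) (a : CornerSequences V) (n : ℕ) :
    m.fst a n = evalAt n m * a n := by
  rw [evalAt, ← mul_apply, ← DoubleCentralizer.fst_mul_apply]
  exact fst_apply_congr m (by simp [proj_mul])

lemma snd_apply (m : 𝓜(ℂ, CornerSequences V)) (a : CornerSequences V) (n : ℕ) :
    m.snd a n = a n * evalAt n m := by
  have h : m.snd a * unitAt V n = a * m.fst (unitAt V n) := m.central _ _
  have h2 : (m.snd a * unitAt V n) n = (a * m.fst (unitAt V n)) n := by rw [h]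
  rwa [mul_apply, mul_apply, unitAt_apply_self, mul_proj] at h2

lemma evalAt_proj (n : ℕ) (m : 𝓜(ℂ, CornerSequences V)) :
    evalAt n m * (V n).starProjection = evalAt n m := mul_proj _ _

lemma proj_evalAt (n : ℕ) (m : 𝓜(ℂ, CornerSequences V)) :
    (V n).starProjection * evalAt n m = evalAt n m := proj_mul _ _

lemma evalAt_one (n : ℕ) : evalAt n (1 : 𝓜(ℂ, CornerSequences V)) = (V n).starProjection :=
  unitAt_apply_self n

lemma evalAt_zero (n : ℕ) : evalAt n (0 : 𝓜(ℂ, CornerSequences V)) = 0 := rfl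

lemma evalAt_sub (n : ℕ) (m m' : 𝓜(ℂ, CornerSequences V)) :
    evalAt n (m - m') = evalAt n m - evalAt n m' := rfl

lemma evalAt_mul (n : ℕ) (m m' : 𝓜(ℂ, CornerSequences V)) :
    evalAt n (m * m') = evalAt n m * evalAt n m' :=
  fst_apply m _ n

lemma evalAt_star (n : ℕ) (m : 𝓜(ℂ, CornerSequences V)) :
    evalAt n (star m) = star (evalAt n m) := by
  have hps : star (V n).starProjection = (V n).starProjection := isSelfAdjoint_starProjection _
  have : evalAt n (star m) = star (m.snd (star (unitAt V n)) n) := by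
    rw [evalAt, DoubleCentralizer.star_fst, star_apply]
  rw [this, snd_apply, star_apply, unitAt_apply_self, hps, proj_evalAt]

lemma evalAt_coe (n : ℕ) (a : CornerSequences V) :
    evalAt n (a : 𝓜(ℂ, CornerSequences V)) = a n := by
  rw [evalAt, DoubleCentralizer.coe_fst]
  exact (congr_arg (a n * ·) (unitAt_apply_self n)).trans (mul_proj a n)

lemma ext_evalAt {m m' : 𝓜(ℂ, CornerSequences V)} (h : ∀ n, evalAt n m = evalAt n m') : m = m' :=
  DoubleCentralizer.ext_fst fun a ↦ ext_of_nat fun n ↦ by rw [fst_apply, fst_apply, h]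

lemma isUnit_of_mem_extremePoints {u : 𝓜(ℂ, CornerSequences V)}
    (hu : u ∈ Set.extremePoints ℝ (Metric.closedBall (0 : 𝓜(ℂ, CornerSequences V)) 1)) :
    IsUnit u := by
  have key (n : ℕ) := corner_unitary_of_defect_mul_defect (proj_evalAt n u) (evalAt_proj n u)
    fun c hc1 hc2 ↦ by
      have := congr_arg (evalAt n) (defect_mul_mul_defect_of_mem_extremePoints hu
        ((single n c hc1 hc2 : CornerSequences V) : 𝓜(ℂ, CornerSequences V)))
      simpa only [evalAt_mul, evalAt_sub, evalAt_one, evalAt_star, evalAt_coe, evalAt_zero,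
        single_apply_self] using this
  refine ⟨⟨u, star u, ext_evalAt fun n ↦ ?_, ext_evalAt fun n ↦ ?_⟩, rfl⟩
  · rw [evalAt_mul, evalAt_star, evalAt_one, (key n).2]
  · rw [evalAt_mul, evalAt_star, evalAt_one, (key n).1]

end CornerSequences

end Locality

/-! ### The representation at infinity -/

section Representation

open Filter Topology OnePoint InnerProductSpace

variable {H : Type} [NormedAddCommGroup H] [InnerProductSpace ℂ H]
variable {V : ℕ → Submodule ℂ H} [∀ n, FiniteDimensional ℂ (V n)]

lemma rankOne_self_apply {e : H} (he1 : ‖e‖ = 1) (ξ : H) : rankOne ℂ ξ e e = ξ := by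
  simp [inner_self_eq_norm_sq_to_K, he1]

lemma norm_starProjection_mul_le (U : Submodule ℂ H) [U.HasOrthogonalProjection]
    (x : H →L[ℂ] H) : ‖U.starProjection * x‖ ≤ ‖x‖ :=
  (norm_mul_le _ _).trans (mul_le_of_le_one_left (norm_nonneg _) U.starProjection_norm_le)

/-- Increasing orthogonal projections converging strongly to `1` converge in norm after
multiplication by an operator of finite rank. -/
lemma tendsto_starProjection_mul (hV : Monotone V) (hd : ⊤ ≤ (⨆ n, V n).topologicalClosure)
    {U : Submodule ℂ H} [FiniteDimensional ℂ U] {x : H →L[ℂ] H} (hx : x * U.starProjection = x) :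
    Tendsto (fun n ↦ (V n).starProjection * x) atTop (𝓝 x) := by
  let y : U →L[ℂ] H := x ∘L U.subtypeL
  have hy (z : H →L[ℂ] H) : z * x = ((z ∘L y) ∘L U.orthogonalProjectionOnto) := by
    conv_lhs => rw [← hx]
    rfl
  let f : OnePoint ℕ → U →L[ℂ] H :=
    fun x ↦ x.elim y fun n ↦ (V n).starProjection ∘L y
  have hf : Continuous f := continuous_clm_apply.2 fun v ↦ (continuous_iff_from_nat _).2
    (Submodule.starProjection_tendsto_self V hV (y v) hd)
  have h := ((continuous_iff_from_nat _).1 hf)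
  have h2 : Tendsto (fun n : ℕ ↦ f n ∘L U.orthogonalProjectionOnto) atTop
      (𝓝 (f ∞ ∘L U.orthogonalProjectionOnto)) :=
    (Continuous.tendsto (by fun_prop : Continuous fun g : U →L[ℂ] H ↦
      g ∘L U.orthogonalProjectionOnto) _).comp h
  have h3 : f ∞ ∘L U.orthogonalProjectionOnto = x := (hy 1).symm.trans (one_mul x)
  rw [h3] at h2
  exact h2.congr fun n ↦ (hy _).symm

variable [CompleteSpace H]

namespace CornerSequences

lemma tendsto_proj_mul (hV : Monotone V) (hd : ⊤ ≤ (⨆ n, V n).topologicalClosure)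
    (T : H →L[ℂ] H) (a : CornerSequences V) :
    Tendsto (fun n ↦ (V n).starProjection * (T * a n)) atTop (𝓝 (T * a ∞)) := by
  have ha : Tendsto (fun n : ℕ ↦ T * a n) atTop (𝓝 (T * a ∞)) := (tendsto a).const_mul T
  rw [Metric.tendsto_atTop] at ha ⊢
  intro ε hε
  obtain ⟨N, hN⟩ := ha (ε / 4) (by positivity)
  obtain ⟨N', hN'⟩ := Metric.tendsto_atTop.1 (tendsto_starProjection_mul hV hd (U := V N)
    (x := T * a N) (by rw [mul_assoc, mul_proj])) (ε / 4) (by positivity)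
  refine ⟨max N N', fun n hn ↦ ?_⟩
  have h1 := hN n (le_of_max_le_left hn)
  have h2 := hN' n (le_of_max_le_right hn)
  have h3 := hN N le_rfl
  rw [dist_eq_norm] at h1 h2 h3 ⊢
  have h4 := norm_starProjection_mul_le (V n) (T * a n - T * a ∞)
  have h5 := norm_starProjection_mul_le (V n) (T * a N - T * a ∞)
  have h6 : (V n).starProjection * (T * a n) - T * a ∞ =
      (V n).starProjection * (T * a n - T * a ∞) - (V n).starProjection * (T * a N - T * a ∞) +
        ((V n).starProjection * (T * a N) - T * a N) + (T * a N - T * a ∞) := by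
    simp only [mul_sub]; abel
  rw [h6]
  refine (norm_add₃_le.trans (add_le_add_left (add_le_add_left (norm_sub_le _ _) _) _)).trans_lt ?_
  linarith

/-- Left multiplication by an operator, compressed to the corners. -/
noncomputable def leftMul (hV : Monotone V) (hd : ⊤ ≤ (⨆ n, V n).topologicalClosure)
    (T : H →L[ℂ] H) : CornerSequences V →L[ℂ] CornerSequences V :=
  LinearMap.mkContinuous
    { toFun a := mk (fun n ↦ (V n).starProjection * (T * a n)) (T * a ∞)
        (tendsto_proj_mul hV hd T a) fun n ↦
          ⟨by rw [← mul_assoc, (V n).isIdempotentElem_starProjection.eq],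
            by rw [mul_assoc, mul_assoc, mul_proj]⟩
      map_add' a b := ext_of_nat fun n ↦ by simp [mul_add]
      map_smul' c a := ext_of_nat fun n ↦ by simp }
    ‖T‖ fun a ↦ norm_le_of_nat fun n ↦ (norm_starProjection_mul_le _ _).trans <|
      (norm_mul_le _ _).trans (mul_le_mul_of_nonneg_left (norm_apply_le a n) (norm_nonneg _))

lemma leftMul_apply (hV : Monotone V) (hd) (T : H →L[ℂ] H) (a : CornerSequences V) (n : ℕ) :
    leftMul hV hd T a n = (V n).starProjection * (T * a n) := rfl

/-- The multiplier of `CornerSequences V` given by an operator on `H`. -/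
noncomputable def ofOperator (hV : Monotone V) (hd : ⊤ ≤ (⨆ n, V n).topologicalClosure)
    (T : H →L[ℂ] H) : 𝓜(ℂ, CornerSequences V) where
  fst := leftMul hV hd T
  snd := (starL ℂ : CornerSequences V ≃L⋆[ℂ] CornerSequences V).toContinuousLinearMap ∘SL
    leftMul hV hd (star T) ∘SL
      (starL ℂ : CornerSequences V ≃L⋆[ℂ] CornerSequences V).toContinuousLinearMap
  central a b := ext_of_nat fun n ↦ by
    have hps : star (V n).starProjection = (V n).starProjection := isSelfAdjoint_starProjection _
    change star (leftMul hV hd (star T) (star a) n) * b n = a n * leftMul hV hd T b n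
    simp only [leftMul_apply, star_apply, star_mul, star_star, hps]
    rw [mul_assoc, proj_mul, ← mul_assoc (a n), mul_proj, mul_assoc]

/-- Evaluation of the limit of a sequence at a vector. -/
noncomputable def limitApply (V : ℕ → Submodule ℂ H) [∀ n, FiniteDimensional ℂ (V n)] (e : H) :
    CornerSequences V →L[ℂ] H :=
  LinearMap.mkContinuous
    { toFun a := a ∞ e
      map_add' a b := by simp
      map_smul' c a := by simp }
    ‖e‖ fun a ↦ ((a ∞).le_opNorm e).trans <| by
      rw [mul_comm]; exact mul_le_mul_of_nonneg_left (norm_apply_le a ∞) (norm_nonneg _)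

variable (hV : Monotone V) (hd : ⊤ ≤ (⨆ n, V n).topologicalClosure) {e : H}

lemma rankOne_mul_proj (he : e ∈ V 0) (hV : Monotone V) (ξ : H) (n : ℕ) :
    rankOne ℂ ξ e * (V n).starProjection = rankOne ℂ ξ e := by
  have h : (V n).starProjection e = e :=
    (V n).starProjection_eq_self_iff.2 (hV (Nat.zero_le n) he)
  have hps : ContinuousLinearMap.adjoint (V n).starProjection = (V n).starProjection :=
    isSelfAdjoint_starProjection _
  rw [ContinuousLinearMap.mul_def, rankOne_comp, hps, h]

/-- The rank one operators `ξ ⊗ e`, compressed to the corners. -/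
noncomputable def column (he : e ∈ V 0) : H →L[ℂ] CornerSequences V :=
  LinearMap.mkContinuous
    { toFun ξ := mk (fun n ↦ (V n).starProjection * rankOne ℂ ξ e) (rankOne ℂ ξ e)
        (tendsto_starProjection_mul hV hd (rankOne_mul_proj he hV ξ 0)) fun n ↦
          ⟨by rw [← mul_assoc, (V n).isIdempotentElem_starProjection.eq],
            by rw [mul_assoc, rankOne_mul_proj he hV]⟩
      map_add' a b := ext_of_nat fun n ↦ by simp [mul_add]
      map_smul' c a := ext_of_nat fun n ↦ by simp }
    ‖e‖ fun ξ ↦ norm_le_of_nat fun n ↦ (norm_starProjection_mul_le _ _).trans <| by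
      rw [norm_rankOne, mul_comm]

lemma column_infty (he : e ∈ V 0) (ξ : H) : column hV hd he ξ ∞ = rankOne ℂ ξ e := rfl

/-- The representation of the multiplier algebra on `H` extending evaluation at infinity. -/
noncomputable def rep (he : e ∈ V 0) (m : 𝓜(ℂ, CornerSequences V)) : H →L[ℂ] H :=
  limitApply V e ∘L m.fst ∘L column hV hd he

lemma rep_apply (he : e ∈ V 0) (m : 𝓜(ℂ, CornerSequences V)) (ξ : H) :
    rep hV hd he m ξ = m.fst (column hV hd he ξ) ∞ e := rfl

lemma rep_sub (he : e ∈ V 0) (m m' : 𝓜(ℂ, CornerSequences V)) :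
    rep hV hd he (m - m') = rep hV hd he m - rep hV hd he m' := by
  ext ξ; simp [rep_apply]

lemma norm_rep_le (he : e ∈ V 0) (he1 : ‖e‖ = 1) (m : 𝓜(ℂ, CornerSequences V)) :
    ‖rep hV hd he m‖ ≤ ‖m‖ := by
  have h1 : ‖limitApply V e‖ ≤ 1 := he1 ▸ LinearMap.mkContinuous_norm_le _ (norm_nonneg _) _
  have h2 : ‖column hV hd he‖ ≤ 1 := he1 ▸ LinearMap.mkContinuous_norm_le _ (norm_nonneg _) _
  calc ‖rep hV hd he m‖ ≤ ‖limitApply V e‖ * (‖m.fst‖ * ‖column hV hd he‖) :=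
        (ContinuousLinearMap.opNorm_comp_le _ _).trans <|
          mul_le_mul_of_nonneg_left (ContinuousLinearMap.opNorm_comp_le _ _) (norm_nonneg _)
    _ ≤ 1 * (‖m.fst‖ * 1) := by gcongr
    _ = ‖m‖ := by rw [one_mul, mul_one, DoubleCentralizer.norm_fst]

lemma rep_one (he : e ∈ V 0) (he1 : ‖e‖ = 1) : rep hV hd he 1 = 1 := by
  ext ξ
  exact rankOne_self_apply he1 ξ

lemma rep_ofOperator (he : e ∈ V 0) (he1 : ‖e‖ = 1) (T : H →L[ℂ] H) :
    rep hV hd he (ofOperator hV hd T) = T := by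
  ext ξ
  exact congr_arg T (rankOne_self_apply he1 ξ)

lemma fst_infty_apply (he : e ∈ V 0) (he1 : ‖e‖ = 1) (m : 𝓜(ℂ, CornerSequences V))
    (a : CornerSequences V) : m.fst a ∞ e = rep hV hd he m (a ∞ e) := by
  have h : (a * column hV hd he e) ∞ = column hV hd he (a ∞ e) ∞ := by
    rw [mul_apply, column_infty, column_infty, ContinuousLinearMap.mul_def, comp_rankOne]
  rw [rep_apply, ← fst_apply_congr m h, DoubleCentralizer.fst_mul_apply, mul_apply, column_infty,
    mul_apply_eq_comp, rankOne_self_apply he1]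

lemma rep_mul (he : e ∈ V 0) (he1 : ‖e‖ = 1) (m m' : 𝓜(ℂ, CornerSequences V)) :
    rep hV hd he (m * m') = rep hV hd he m * rep hV hd he m' := by
  ext ξ
  exact fst_infty_apply hV hd he he1 m _

lemma isUnit_rep (he : e ∈ V 0) (he1 : ‖e‖ = 1) {m : 𝓜(ℂ, CornerSequences V)} (hm : IsUnit m) :
    IsUnit (rep hV hd he m) := by
  obtain ⟨u, rfl⟩ := hm
  exact ⟨⟨rep hV hd he u, rep hV hd he ↑u⁻¹,
    by rw [← rep_mul hV hd he he1, Units.mul_inv, rep_one hV hd he he1],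
    by rw [← rep_mul hV hd he he1, Units.inv_mul, rep_one hV hd he he1]⟩, rfl⟩

/-- The multiplier algebra of `CornerSequences V` is not extremally rich, provided that `H` carries
a non-unitary isometry. -/
theorem not_extremallyRich (hV : Monotone V) (hd : ⊤ ≤ (⨆ n, V n).topologicalClosure)
    (he : e ∈ V 0) (he1 : ‖e‖ = 1) {S : H →L[ℂ] H} (hS : star S * S = 1)
    (hS' : ¬ IsUnit S) : ¬ ExtremallyRich 𝓜(ℂ, CornerSequences V) := by
  intro hER
  obtain ⟨m, hm, x, u, y, hx, hy, hu, rfl⟩ := Metric.dense_iff.1 hER (ofOperator hV hd S) 1 one_pos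
  have hunit := isUnit_rep hV hd he he1 ((hx.mul (isUnit_of_mem_extremePoints hu)).mul hy)
  set R := rep hV hd he (x * u * y) with hR
  have hRS : ‖R - S‖ < 1 := by
    rw [hR, ← rep_ofOperator hV hd he he1 S, ← rep_sub]
    exact (norm_rep_le hV hd he he1 _).trans_lt (mem_ball_iff_norm.1 hm)
  have hSnorm : ‖star S‖ ≤ 1 := by
    have h : ‖S‖ * ‖S‖ ≤ 1 := by
      rw [← CStarRing.norm_star_mul_self, hS]
      exact ContinuousLinearMap.norm_id_le
    rw [norm_star]
    nlinarith [norm_nonneg S]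
  have h1 : ‖1 - star S * R‖ < 1 := by
    rw [← hS, ← mul_sub]
    refine (norm_mul_le _ _).trans_lt ?_
    rw [norm_sub_rev]
    nlinarith [norm_nonneg (R - S)]
  have h2 : IsUnit (star S * R) := by
    simpa using (Units.oneSub _ h1).isUnit
  have h3 : IsUnit (star S) := by
    obtain ⟨r, hr⟩ := hunit
    rw [← hr] at h2
    exact (Units.isUnit_mul_units _ r).1 h2
  exact hS' (by simpa using h3.star)

end CornerSequences

end Representation

section Shift

open InnerProductSpace

variable {H : Type} [NormedAddCommGroup H] [InnerProductSpace ℂ H] [CompleteSpace H]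

/-- A Hilbert space with a countably infinite Hilbert basis carries a non-unitary isometry. -/
lemma HilbertBasis.exists_isometry_not_isUnit (b : HilbertBasis ℕ ℂ H) :
    ∃ S : H →L[ℂ] H, star S * S = 1 ∧ ¬ IsUnit S := by
  have ho : Orthonormal ℂ fun n ↦ b (n + 1) := b.orthonormal.comp _ (add_left_injective 1)
  let W := ho.orthogonalFamily.linearIsometry
  let S : H →ₗᵢ[ℂ] H := W.comp b.repr.toLinearIsometry
  refine ⟨S.toContinuousLinearMap, ?_, fun h ↦ ?_⟩
  · exact (ContinuousLinearMap.norm_map_iff_adjoint_comp_self _).1 S.norm_map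
  · obtain ⟨u, hu⟩ := h
    have h1 : S ((↑u⁻¹ : H →L[ℂ] H) (b 0)) = b 0 := by
      have := congr_arg (· (b 0)) u.mul_inv
      rwa [hu] at this
    have h2 (f) : inner ℂ (b 0) (W f) = 0 := by
      have := (ho.orthogonalFamily.hasSum_linearIsometry f).mapL (innerSL ℂ (b 0))
      refine this.unique ?_
      convert hasSum_zero with i
      simp [b.orthonormal.2 (Nat.succ_ne_zero i).symm]
    have h3 := h2 (b.repr ((↑u⁻¹ : H →L[ℂ] H) (b 0)))
    have h4 : W (b.repr ((↑u⁻¹ : H →L[ℂ] H) (b 0))) = b 0 := h1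
    rw [h4, inner_self_eq_norm_sq_to_K, b.orthonormal.1 0] at h3
    simp at h3

end Shift

noncomputable section HilbertBasis

variable {H : Type} [NormedAddCommGroup H] [InnerProductSpace ℂ H]

/-- The span of the first vectors of a Hilbert basis. -/
def HilbertBasis.initialSpan (b : HilbertBasis ℕ ℂ H) (n : ℕ) : Submodule ℂ H :=
  Submodule.span ℂ (b '' Set.Iic n)

instance (b : HilbertBasis ℕ ℂ H) (n : ℕ) : FiniteDimensional ℂ (b.initialSpan n) :=
  FiniteDimensional.span_of_finite ℂ ((Set.finite_Iic n).image b)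

lemma HilbertBasis.initialSpan_mono (b : HilbertBasis ℕ ℂ H) : Monotone b.initialSpan :=
  fun _ _ h ↦ Submodule.span_mono (Set.image_mono (Set.Iic_subset_Iic.2 h))

lemma HilbertBasis.top_le_closure_iSup_initialSpan (b : HilbertBasis ℕ ℂ H) :
    ⊤ ≤ (⨆ n, b.initialSpan n).topologicalClosure := by
  rw [← b.dense_span]
  refine Submodule.topologicalClosure_mono (Submodule.span_le.2 ?_)
  rintro _ ⟨n, rfl⟩
  exact Submodule.mem_iSup_of_mem n (Submodule.subset_span ⟨n, Set.self_mem_Iic, rfl⟩)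

end HilbertBasis

/-- There exists a C*-algebra `I` of stable rank one whose multiplier
algebra `𝓜(ℂ, I)` is not extremally rich. -/
theorem stmt17 : Nonempty Stmt17Witness := by
  let b : HilbertBasis ℕ ℂ (lp (fun _ : ℕ ↦ ℂ) 2) := .ofRepr (LinearIsometryEquiv.refl ℂ _)
  obtain ⟨S, hS, hS'⟩ := b.exists_isometry_not_isUnit
  exact ⟨{
    I := CornerSequences b.initialSpan
    sr1 := CornerSequences.dense_isUnit b.initialSpan_mono
    notER := CornerSequences.not_extremallyRich b.initialSpan_mono
      b.top_le_closure_iSup_initialSpan (Submodule.subset_span ⟨0, Set.self_mem_Iic, rfl⟩)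
      (b.orthonormal.1 0) hS hS' }⟩
end

section
/- There exists a C*-algebra I of stable rank one and an isometry v (i.e., v* v = 1, hence an extreme point of the closed unit ball) in the corona algebra C(I) = M(I)/I such that no extreme point of the closed unit ball of M(I) is mapped to v by the quotient map M(I) → C(I). -/
open scoped MultiplierAlgebra

/-- A witness for Statement 18: a C*-algebra `I` of stable rank one together with a
realization `π : 𝓜(ℂ, I) → C` of the corona algebra `C = C(I) = 𝓜(ℂ, I)/I` (a surjective
star homomorphism whose kernel is the canonical image of `I` in the multiplier algebra),
and an isometry `v` of the corona algebra which is not the image under `π` of any extreme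
point of the closed unit ball of `𝓜(ℂ, I)`. -/
structure Stmt18Witness : Type 1 where
  /-- The C*-algebra `I`. -/
  I : Type
  [instI : NonUnitalCStarAlgebra I]
  /-- `I` has stable rank one: the invertibles are dense in its minimal unitization. -/
  sr1 : Dense {x : Unitization ℂ I | IsUnit x}
  /-- The corona algebra `C(I) = 𝓜(ℂ, I)/I`. -/
  C : Type
  [instC : CStarAlgebra C]
  /-- The quotient map `𝓜(ℂ, I) → C(I)`. -/
  π : 𝓜(ℂ, I) →⋆ₐ[ℂ] C
  surj : Function.Surjective π
  ker : ∀ m : 𝓜(ℂ, I), π m = 0 ↔ ∃ x : I, m = (x : 𝓜(ℂ, I))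
  /-- The isometry of the corona algebra; isometries are extreme points of the closed unit
  ball. -/
  v : C
  isometry : star v * v = 1
  nolift : ∀ w ∈ Set.extremePoints ℝ (Metric.closedBall (0 : 𝓜(ℂ, I)) 1), π w ≠ v

section Quotient

variable {A : Type*} [CStarAlgebra A] (J : Ideal A) [J.IsTwoSided]

/-- An ideal of a C⋆-algebra which is invariant under the star operation and has right approximate
units `e` with `‖1 - e‖ ≤ 1`. -/
structure Ideal.HasApproxUnits (J : Ideal A) : Prop where
  star_mem : ∀ x ∈ J, star x ∈ J
  exists_approx : ∀ x ∈ J, ∀ ε > 0, ∃ e ∈ J, ‖1 - e‖ ≤ 1 ∧ ‖x * (1 - e)‖ < ε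

omit [J.IsTwoSided] in
variable {J} in
theorem Ideal.HasApproxUnits.norm_mk_sq_le (hJ : J.HasApproxUnits) (a : A) :
    ‖(Submodule.Quotient.mk a : A ⧸ J)‖ * ‖(Submodule.Quotient.mk a : A ⧸ J)‖ ≤
      ‖(Submodule.Quotient.mk (star a * a) : A ⧸ J)‖ := by
  refine le_of_forall_pos_le_add fun ε hε ↦ ?_
  obtain ⟨b, hb, hb'⟩ :=
    Submodule.Quotient.norm_mk_lt (Submodule.Quotient.mk (star a * a) : A ⧸ J) (half_pos hε)
  obtain ⟨e, he, he1, he2⟩ := hJ.exists_approx (star a * a - b)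
    ((Submodule.Quotient.eq J).mp hb.symm) (ε / 2) (half_pos hε)
  have hmk : (Submodule.Quotient.mk a : A ⧸ J) = Submodule.Quotient.mk (a * (1 - e)) := by
    rw [Submodule.Quotient.eq, mul_sub, mul_one, sub_sub_cancel]
    exact J.mul_mem_left _ he
  calc _ ≤ ‖a * (1 - e)‖ * ‖a * (1 - e)‖ := by
        rw [hmk]
        gcongr <;> exact Submodule.Quotient.norm_mk_le J _
    _ = ‖star (1 - e) * (star a * a * (1 - e))‖ := by
        rw [← CStarRing.norm_star_mul_self, star_mul]
        simp only [mul_assoc]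
    _ ≤ ‖star a * a * (1 - e)‖ := by
        refine (norm_mul_le _ _).trans (mul_le_of_le_one_left (norm_nonneg _) ?_)
        rwa [norm_star]
    _ = ‖b * (1 - e) + (star a * a - b) * (1 - e)‖ := by rw [← add_mul, add_sub_cancel]
    _ ≤ ‖b‖ + ε / 2 := by
        refine (norm_add_le _ _).trans (add_le_add ?_ he2.le)
        exact (norm_mul_le _ _).trans (mul_le_of_le_one_right (norm_nonneg _) he1)
    _ ≤ _ := by linarith

variable {J} in
/-- The quotient of a C⋆-algebra by a closed ideal with approximate units. -/
noncomputable abbrev Ideal.HasApproxUnits.cstarAlgebra (hJ : J.HasApproxUnits)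
    (hc : IsClosed (J : Set A)) : CStarAlgebra (A ⧸ J) :=
  haveI : IsClosed (J : Set A) := hc
  letI : NormedRing (A ⧸ J) :=
    { Submodule.Quotient.normedAddCommGroup J, Ideal.Quotient.ring J with
      norm_mul_le := by
        intro x y
        refine le_of_forall_pos_le_add fun ε hε ↦ ?_
        have : Filter.Tendsto (fun δ : ℝ ↦ (‖x‖ + δ) * (‖y‖ + δ)) (nhdsWithin 0 (Set.Ioi 0))
            (nhds (‖x‖ * ‖y‖)) := by
          have : Continuous (fun δ : ℝ ↦ (‖x‖ + δ) * (‖y‖ + δ)) := by fun_prop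
          simpa using (this.tendsto 0).mono_left nhdsWithin_le_nhds
        obtain ⟨δ, h1, h2⟩ := ((this.eventually (gt_mem_nhds (lt_add_of_pos_right _ hε))).and
          self_mem_nhdsWithin).exists
        obtain ⟨a, rfl, ha⟩ := Submodule.Quotient.norm_mk_lt x h2
        obtain ⟨b, rfl, hb⟩ := Submodule.Quotient.norm_mk_lt y h2
        refine le_trans ?_ h1.le
        refine (Submodule.Quotient.norm_mk_le J (a * b)).trans ((norm_mul_le a b).trans ?_)
        gcongr }
  letI : StarRing (A ⧸ J) :=
    { star := Quotient.map' star fun a b h ↦ by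
        rw [Submodule.quotientRel_def] at h ⊢
        rw [← star_sub]
        exact hJ.star_mem _ h
      star_involutive := by
        rintro ⟨a⟩
        exact congrArg (Submodule.Quotient.mk (p := J)) (star_star a)
      star_mul := by
        rintro ⟨a⟩ ⟨b⟩
        exact congrArg (Submodule.Quotient.mk (p := J)) (star_mul a b)
      star_add := by
        rintro ⟨a⟩ ⟨b⟩
        exact congrArg (Submodule.Quotient.mk (p := J)) (star_add a b) }
  letI : NormedAlgebra ℂ (A ⧸ J) :=
    { Submodule.Quotient.normedSpace J ℂ, Ideal.Quotient.algebra ℂ with }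
  { norm_mul_self_le := by
      rintro ⟨a⟩
      exact hJ.norm_mk_sq_le a
    star_smul := by
      rintro r ⟨a⟩
      exact congrArg (Submodule.Quotient.mk (p := J)) (star_smul r a) }

theorem Ideal.HasApproxUnits.exists_quotient {A : Type} [CStarAlgebra A] {J : Ideal A}
    [J.IsTwoSided] (hJ : J.HasApproxUnits) (hc : IsClosed (J : Set A)) :
    ∃ (C : Type) (_ : CStarAlgebra C) (π : A →⋆ₐ[ℂ] C),
      Function.Surjective π ∧ ∀ a, π a = 0 ↔ a ∈ J := by
  let := hJ.cstarAlgebra hc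
  refine ⟨A ⧸ J, inferInstance, { Ideal.Quotient.mkₐ ℂ J with map_star' := fun a ↦ rfl }, ?_, ?_⟩
  · exact Ideal.Quotient.mk_surjective
  · exact fun a ↦ Ideal.Quotient.eq_zero_iff_mem

end Quotient

section StableRank

open Filter Topology

theorem IsAlgebraic.mem_closure_isUnit {A : Type*} [TopologicalSpace A] [Ring A] [Algebra ℂ A]
    [ContinuousAdd A] [ContinuousSMul ℂ A] {x : A} (hx : IsAlgebraic ℂ x) :
    x ∈ closure {y : A | IsUnit y} := by
  obtain ⟨p, hp0, hp⟩ := hx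
  have hfin : (spectrum ℂ x).Finite := by
    refine p.roots.toFinset.finite_toSet.subset fun r hr ↦ ?_
    have h := spectrum.subset_polynomial_aeval x p ⟨r, hr, rfl⟩
    rw [hp] at h
    have : Nontrivial A := by
      by_contra h'
      rw [not_nontrivial_iff_subsingleton] at h'
      simp [spectrum.of_subsingleton] at hr
    rw [spectrum.zero_eq] at h
    simpa [hp0] using h
  have hev : ∀ᶠ r : ℂ in 𝓝[≠] 0, IsUnit (x - algebraMap ℂ A r) := by
    have := (hfin.subset Set.sdiff_subset :
      (spectrum ℂ x \ {0}).Finite).isClosed.isOpen_compl.mem_nhds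
        (by simp : (0 : ℂ) ∈ (spectrum ℂ x \ {0})ᶜ)
    filter_upwards [mem_nhdsWithin_of_mem_nhds this, self_mem_nhdsWithin] with r hr hr0
    have : r ∉ spectrum ℂ x := fun h ↦ hr ⟨h, hr0⟩
    rw [spectrum.notMem_iff] at this
    simpa using this.neg
  refine mem_closure_of_tendsto (f := fun r : ℂ ↦ x - algebraMap ℂ A r) ?_ hev
  have : Continuous fun r : ℂ ↦ x + (-r) • (1 : A) := by fun_prop
  simpa [Algebra.algebraMap_eq_smul_one, sub_eq_add_neg] using
    (this.tendsto 0).mono_left nhdsWithin_le_nhds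

theorem dense_isUnit_unitization {A : Type*} [NonUnitalCStarAlgebra A]
    (h : Dense {x : A | ∃ W : NonUnitalSubalgebra ℂ A, Module.Finite ℂ W ∧ x ∈ W}) :
    Dense {x : Unitization ℂ A | IsUnit x} := by
  have key : ∀ (r : ℂ) (x : A),
      (Unitization.inl r + (x : Unitization ℂ A)) ∈ closure {x : Unitization ℂ A | IsUnit x} := by
    intro r
    have hc : Continuous fun x : A ↦ Unitization.inl r + (x : Unitization ℂ A) :=
      continuous_const.add Unitization.isometry_inr.continuous
    refine fun x ↦ h.induction (P := fun x ↦ Unitization.inl r + (x : Unitization ℂ A) ∈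
      closure {x : Unitization ℂ A | IsUnit x}) ?_ (isClosed_closure.preimage hc) x
    rintro x ⟨W, hW, hx⟩
    refine IsAlgebraic.mem_closure_isUnit ?_
    have : Module.Finite ℂ (Unitization ℂ W) :=
      Module.Finite.of_surjective
        ((Algebra.linearMap ℂ (Unitization ℂ W)).coprod (Unitization.inrHom ℂ ℂ W))
        fun y ↦ ⟨(y.fst, y.snd), Unitization.inl_fst_add_inr_snd_eq y⟩
    have := (Algebra.IsAlgebraic.isAlgebraic (R := ℂ)
      (Unitization.inl r + ((⟨x, hx⟩ : W) : Unitization ℂ W))).algHom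
      (Unitization.lift ((Unitization.inrNonUnitalAlgHom ℂ A).comp
        (NonUnitalSubalgebraClass.subtype W)))
    simpa [Unitization.algebraMap_eq_inl] using this
  intro x
  rw [← Unitization.inl_fst_add_inr_snd_eq x]
  exact key _ _

end StableRank

namespace DoubleCentralizer

variable {A : Type*} [CStarAlgebra A] {I : NonUnitalStarSubalgebra ℂ A} [IsClosed (I : Set A)]

/-- The multiplier `m` of a subalgebra acts as multiplication by the element `a` of the ambient
algebra. -/
structure ImplementedBy (m : 𝓜(ℂ, I)) (a : A) : Prop where
  fst_apply : ∀ x : I, (m.fst x : A) = a * x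
  snd_apply : ∀ x : I, (m.snd x : A) = x * a

namespace ImplementedBy

variable {m n : 𝓜(ℂ, I)} {a b : A}

theorem one : ImplementedBy (1 : 𝓜(ℂ, I)) 1 where
  fst_apply x := by simp
  snd_apply x := by simp

theorem coe (x : I) : ImplementedBy (x : 𝓜(ℂ, I)) (x : A) where
  fst_apply y := by simp
  snd_apply y := by simp

theorem add (hm : ImplementedBy m a) (hn : ImplementedBy n b) : ImplementedBy (m + n) (a + b) where
  fst_apply x := by simp [hm.fst_apply, hn.fst_apply, add_mul]
  snd_apply x := by simp [hm.snd_apply, hn.snd_apply, mul_add]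

theorem sub (hm : ImplementedBy m a) (hn : ImplementedBy n b) : ImplementedBy (m - n) (a - b) where
  fst_apply x := by simp [hm.fst_apply, hn.fst_apply, sub_mul]
  snd_apply x := by simp [hm.snd_apply, hn.snd_apply, mul_sub]

theorem mul (hm : ImplementedBy m a) (hn : ImplementedBy n b) : ImplementedBy (m * n) (a * b) where
  fst_apply x := by simp [hm.fst_apply, hn.fst_apply, mul_assoc]
  snd_apply x := by simp [hm.snd_apply, hn.snd_apply, mul_assoc]

theorem star (hm : ImplementedBy m a) : ImplementedBy (star m) (star a) where
  fst_apply x := by simp [hm.snd_apply]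
  snd_apply x := by simp [hm.fst_apply]

theorem exists_of_mul_mem (hl : ∀ x ∈ I, a * x ∈ I) (hr : ∀ x ∈ I, x * a ∈ I) :
    ∃ m : 𝓜(ℂ, I), ImplementedBy m a := by
  let L : I →L[ℂ] I := LinearMap.mkContinuous
    { toFun := fun x ↦ ⟨a * x, hl x x.2⟩
      map_add' := fun x y ↦ Subtype.ext (mul_add a (x : A) y)
      map_smul' := fun r x ↦ Subtype.ext (mul_smul_comm r a (x : A)) } ‖a‖
    fun x ↦ norm_mul_le a (x : A)
  let R : I →L[ℂ] I := LinearMap.mkContinuous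
    { toFun := fun x ↦ ⟨x * a, hr x x.2⟩
      map_add' := fun x y ↦ Subtype.ext (add_mul (x : A) y a)
      map_smul' := fun r x ↦ Subtype.ext (smul_mul_assoc r (x : A) a) } ‖a‖
    fun x ↦ (norm_mul_le (x : A) a).trans_eq (mul_comm _ _)
  exact ⟨⟨(L, R), fun x y ↦ Subtype.ext (mul_assoc (x : A) a y)⟩, fun x ↦ rfl, fun x ↦ rfl⟩

end ImplementedBy

end DoubleCentralizer

section Range

variable {I : Type*} [NonUnitalCStarAlgebra I]

namespace DoubleCentralizer

theorem eq_of_forall_mul_eq {x y : I} (h : ∀ z, z * x = z * y) : x = y := by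
  rw [← sub_eq_zero, ← CStarRing.star_mul_self_eq_zero_iff, mul_sub, sub_eq_zero]
  exact h _

theorem fst_mul (m : 𝓜(ℂ, I)) (x y : I) : m.fst (x * y) = m.fst x * y :=
  eq_of_forall_mul_eq fun z ↦ by rw [← m.central, ← mul_assoc, m.central, mul_assoc]

theorem mul_coe (m : 𝓜(ℂ, I)) (x : I) : m * (x : 𝓜(ℂ, I)) = (m.fst x : I) := by
  ext y
  · simp [fst_mul]
  · simp [m.central]

variable (I) in
/-- The canonical image of a C⋆-algebra in its multiplier algebra, as an ideal. -/
noncomputable def rangeIdeal : Ideal 𝓜(ℂ, I) where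
  carrier := Set.range (DoubleCentralizer.coe ℂ)
  zero_mem' := ⟨0, map_zero (coeHom : I →⋆ₙₐ[ℂ] 𝓜(ℂ, I))⟩
  add_mem' := by
    rintro _ _ ⟨x, rfl⟩ ⟨y, rfl⟩
    exact ⟨x + y, map_add (coeHom : I →⋆ₙₐ[ℂ] 𝓜(ℂ, I)) x y⟩
  smul_mem' := by
    rintro m _ ⟨x, rfl⟩
    exact ⟨m.fst x, (mul_coe m x).symm⟩

theorem mem_rangeIdeal {m : 𝓜(ℂ, I)} : m ∈ rangeIdeal I ↔ ∃ x : I, m = (x : 𝓜(ℂ, I)) :=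
  exists_congr fun _ ↦ eq_comm

theorem star_coe (x : I) : star (x : 𝓜(ℂ, I)) = ((star x : I) : 𝓜(ℂ, I)) :=
  (map_star (coeHom : I →⋆ₙₐ[ℂ] 𝓜(ℂ, I)) x).symm

theorem star_mem_rangeIdeal {m : 𝓜(ℂ, I)} (hm : m ∈ rangeIdeal I) : star m ∈ rangeIdeal I := by
  obtain ⟨x, rfl⟩ := hm
  exact ⟨star x, (star_coe x).symm⟩

instance : (rangeIdeal I).IsTwoSided where
  mul_mem_of_left {m} n hm := by
    have := star_mem_rangeIdeal ((rangeIdeal I).mul_mem_left (star n) (star_mem_rangeIdeal hm))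
    simpa using this

theorem norm_coe (x : I) : ‖(x : 𝓜(ℂ, I))‖ = ‖x‖ := by
  rw [← norm_fst, coe_fst]
  exact ContinuousLinearMap.opNorm_mul_apply ℂ I x

theorem isClosed_rangeIdeal : IsClosed (rangeIdeal I : Set 𝓜(ℂ, I)) := by
  have : Isometry (coeHom : I →⋆ₙₐ[ℂ] 𝓜(ℂ, I)) :=
    AddMonoidHomClass.isometry_of_norm _ norm_coe
  exact this.isClosedEmbedding.isClosed_range

theorem hasApproxUnits_rangeIdeal
    (h : ∀ x : I, ∀ ε > 0, ∃ u : I, IsStarProjection u ∧ ‖x - x * u‖ < ε) :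
    (rangeIdeal I).HasApproxUnits where
  star_mem _ := star_mem_rangeIdeal
  exists_approx := by
    rintro _ ⟨x, rfl⟩ ε hε
    obtain ⟨u, hu, hxu⟩ := h x ε hε
    refine ⟨(u : 𝓜(ℂ, I)), ⟨u, rfl⟩,
      ((hu.map (coeHom : I →⋆ₙₐ[ℂ] 𝓜(ℂ, I))).one_sub).norm_le, ?_⟩
    have : (x : 𝓜(ℂ, I)) * (1 - (u : 𝓜(ℂ, I))) = ((x - x * u : I) : 𝓜(ℂ, I)) := by
      rw [mul_sub, mul_one, mul_coe, coe_fst]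
      exact (map_sub (coeHom : I →⋆ₙₐ[ℂ] 𝓜(ℂ, I)) x (x * u)).symm
    rwa [this, norm_coe]

theorem exists_corona {I : Type} [NonUnitalCStarAlgebra I] (h : (rangeIdeal I).HasApproxUnits) :
    ∃ (C : Type) (_ : CStarAlgebra C) (π : 𝓜(ℂ, I) →⋆ₐ[ℂ] C),
      Function.Surjective π ∧ ∀ m, π m = 0 ↔ ∃ x : I, m = (x : 𝓜(ℂ, I)) := by
  simpa only [mem_rangeIdeal] using h.exists_quotient isClosed_rangeIdeal

end DoubleCentralizer

end Range

section Extreme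

open CStarAlgebra

variable {A : Type*} [CStarAlgebra A]

theorem defect_mul_mul_defect_eq_zero {w : A}
    (hw : w ∈ Set.extremePoints ℝ (Metric.closedBall (0 : A) 1)) (y : A) :
    (1 - w * star w) * y * (1 - star w * w) = 0 := by
  let := CStarAlgebra.spectralOrder A
  let := CStarAlgebra.spectralOrderedRing A
  have hw1 : ‖w‖ ≤ 1 := by simpa using hw.1
  wlog hy : ‖y‖ ≤ 1 / 3 generalizing y
  · have hpos : 0 < 3 * (‖y‖ + 1) := by positivity
    have h := this ((3 * (‖y‖ + 1))⁻¹ • y) <| by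
      rw [norm_smul, norm_inv, Real.norm_of_nonneg hpos.le, inv_mul_le_iff₀ hpos]
      linarith
    rw [mul_smul_comm, smul_mul_assoc] at h
    exact (smul_eq_zero.mp h).resolve_left (inv_ne_zero hpos.ne')
  set D := 1 - star w * w with hD
  set D' := 1 - w * star w with hD'
  have key : ∀ y : A, ‖y‖ ≤ 1 / 3 → w + D' * y * D ∈ Metric.closedBall (0 : A) 1 := by
    intro y hy
    have hD'0 : 0 ≤ D' := by
      rw [hD', sub_nonneg, ← norm_le_one_iff_of_nonneg _ (mul_star_self_nonneg w)]
      rw [CStarRing.norm_self_mul_star]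
      exact mul_le_one₀ hw1 (norm_nonneg _) hw1
    have hD'1 : ‖D'‖ ≤ 1 := by
      rw [norm_le_one_iff_of_nonneg _ hD'0, hD']
      exact sub_le_self _ (mul_star_self_nonneg w)
    have hDs : IsSelfAdjoint D := by simp [hD, IsSelfAdjoint]
    have hD's : star D' = D' := by simp [hD']
    have hwD : star w * D' = D * star w := by simp only [hD, hD']; noncomm_ring
    have hwD' : D' * w = w * D := by simp only [hD, hD']; noncomm_ring
    set z := star w * y + star y * w + star y * (D' * D') * y with hz
    have hzs : IsSelfAdjoint z := by
      simp [hz, IsSelfAdjoint, hD's, mul_assoc, add_comm]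
    have hz1 : ‖z‖ ≤ 1 := by
      have h1 : ‖star w * y‖ ≤ 1 * (1 / 3) := norm_mul_le_of_le (by simpa using hw1) hy
      have h2 : ‖star y * w‖ ≤ 1 / 3 * 1 := norm_mul_le_of_le (by simpa using hy) hw1
      have h3 : ‖star y * (D' * D') * y‖ ≤ 1 / 3 * (1 * 1) * (1 / 3) :=
        norm_mul_le_of_le (norm_mul_le_of_le (by simpa using hy)
          (norm_mul_le_of_le hD'1 hD'1)) hy
      have := norm_add₃_le (a := star w * y) (b := star y * w) (c := star y * (D' * D') * y)
      linarith
    have hz2 : z ≤ 1 := hzs.le_algebraMap_norm_self.trans <| by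
      simpa using algebraMap_mono A hz1
    have hexp : star (w + D' * y * D) * (w + D' * y * D) = star w * w + D * z * D := by
      rw [star_add, star_mul, star_mul, hDs.star_eq, hD's]
      calc _ = star w * w + (star w * D') * y * D + D * star y * (D' * w)
            + D * star y * (D' * D') * y * D := by noncomm_ring
        _ = _ := by rw [hwD, hwD', hz]; noncomm_ring
    have hDD : D * D ≤ D := by
      rw [← sub_nonneg, show D - D * D = star w * D' * w by simp only [hD, hD']; noncomm_ring]
      exact star_left_conjugate_nonneg hD'0 w
    rw [mem_closedBall_zero_iff, ← sq_le_one_iff₀ (norm_nonneg _), sq,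
      ← CStarRing.norm_star_mul_self, norm_le_one_iff_of_nonneg _ (star_mul_self_nonneg _), hexp]
    calc star w * w + D * z * D ≤ star w * w + D * 1 * D := by
          gcongr
          exact hDs.conjugate_le_conjugate hz2
      _ ≤ star w * w + D := by rw [mul_one]; gcongr
      _ = 1 := by rw [hD]; abel
  have h2 := hw.2 (key y hy) (key (-y) (by simpa using hy)) ?_
  · simpa using h2
  · rw [openSegment_eq_image]
    refine ⟨1 / 2, by norm_num, ?_⟩
    simp only [mul_neg, neg_mul, smul_add, smul_neg]
    module

end Extreme

section Subalgebra

variable {A : Type*} [CStarAlgebra A] {I : NonUnitalStarSubalgebra ℂ A} [IsClosed (I : Set A)]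

theorem NonUnitalStarSubalgebra.dense_isUnit_unitization
    (h : ∀ x ∈ I, ∀ ε > 0, ∃ S ≤ I, Module.Finite ℂ S ∧ ∃ y ∈ S, ‖x - y‖ < ε) :
    Dense {x : Unitization ℂ I | IsUnit x} := by
  refine _root_.dense_isUnit_unitization fun x ↦ Metric.mem_closure_iff.mpr fun ε hε ↦ ?_
  obtain ⟨S, hSI, hS, y, hy, hxy⟩ := h x x.2 ε hε
  let W : NonUnitalSubalgebra ℂ I :=
    (S.comap (NonUnitalStarSubalgebraClass.subtype I)).toNonUnitalSubalgebra
  let Φ : W →ₗ[ℂ] S :=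
    { toFun := fun z ↦ ⟨z, z.2⟩
      map_add' := fun _ _ ↦ rfl
      map_smul' := fun _ _ ↦ rfl }
  have hΦ : Function.Injective Φ := fun z z' hz ↦ Subtype.ext (Subtype.ext congr(($hz : A)))
  refine ⟨⟨y, hSI hy⟩, ⟨W, Module.Finite.of_injective Φ hΦ, hy⟩, ?_⟩
  rwa [dist_eq_norm]

namespace DoubleCentralizer

theorem ImplementedBy.eq_one {m : 𝓜(ℂ, I)} {a : A} (hm : ImplementedBy m a)
    (h : ∀ x ∈ I, a * x = x ∧ x * a = x) : m = 1 := by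
  ext x
  · simp [hm.fst_apply, (h x x.2).1]
  · simp [hm.snd_apply, (h x x.2).2]

theorem ImplementedBy.defect_mul_mul_defect_mul_eq_zero {w : 𝓜(ℂ, I)} {a : A}
    (ha : ImplementedBy w a)
    (hw : w ∈ Set.extremePoints ℝ (Metric.closedBall (0 : 𝓜(ℂ, I)) 1)) {x y : A}
    (hx : x ∈ I) (hy : y ∈ I) :
    (1 - a * Star.star a) * x * (1 - Star.star a * a) * y = 0 := by
  have h := ((one.sub (ha.mul ha.star)).mul (coe (⟨x, hx⟩ : I))).mul (one.sub (ha.star.mul ha))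
  rw [_root_.defect_mul_mul_defect_eq_zero hw] at h
  simpa using (h.fst_apply ⟨y, hy⟩).symm

end DoubleCentralizer

open DoubleCentralizer in
theorem nonempty_stmt18Witness {A : Type} [CStarAlgebra A] {I : NonUnitalStarSubalgebra ℂ A}
    [IsClosed (I : Set A)] (hsr : Dense {x : Unitization ℂ I | IsUnit x})
    (hu : ∀ x : I, ∀ ε > 0, ∃ u : I, IsStarProjection u ∧ ‖x - x * u‖ < ε) {t c : A}
    (hl : ∀ x ∈ I, t * x ∈ I) (hr : ∀ x ∈ I, x * t ∈ I) (hc : c ∈ I)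
    (hunit : ∀ x ∈ I, (star t * t + c) * x = x ∧ x * (star t * t + c) = x)
    (hext : ∀ a, a - t ∈ I →
      ∃ x ∈ I, ∃ y ∈ I, (1 - a * star a) * x * (1 - star a * a) * y ≠ 0) :
    Nonempty Stmt18Witness := by
  obtain ⟨C, _, π, hsurj, hker⟩ := exists_corona (hasApproxUnits_rangeIdeal hu)
  obtain ⟨T, hT⟩ := ImplementedBy.exists_of_mul_mem hl hr
  refine ⟨⟨I, hsr, C, π, hsurj, hker, π T, ?_, fun w hw hwT ↦ ?_⟩⟩
  · have h1 := ((hT.star.mul hT).add (ImplementedBy.coe (⟨c, hc⟩ : I))).eq_one hunit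
    have h2 := congr(π $h1)
    rwa [map_add, (hker _).mpr ⟨_, rfl⟩, add_zero, map_mul, map_star, map_one] at h2
  · obtain ⟨i, hi⟩ := (hker (w - T)).mp (by rw [map_sub, hwT, sub_self])
    have hwi : ImplementedBy w (t + i) := by
      rw [← add_sub_cancel T w, hi]
      exact hT.add (ImplementedBy.coe i)
    obtain ⟨x, hx, y, hy, h⟩ := hext (t + i) (by rw [add_sub_cancel_left]; exact i.2)
    exact h (hwi.defect_mul_mul_defect_mul_eq_zero hw hx hy)

end Subalgebra

namespace ShiftExample

open InnerProductSpace BoundedContinuousFunction Finset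

variable {H : Type*} [NormedAddCommGroup H] [InnerProductSpace ℂ H] [CompleteSpace H] (e : ℕ → H)

/-- The matrix unit sending `e j` to `e i`. -/
noncomputable def matUnit (i j : ℕ) : H →L[ℂ] H := rankOne ℂ (e i) (e j)

theorem star_matUnit (i j : ℕ) : star (matUnit e i j) = matUnit e j i := by
  simp [matUnit, ContinuousLinearMap.star_eq_adjoint]

/-- The projection onto the span of `e 0, …, e n`. -/
noncomputable def proj (n : ℕ) : H →L[ℂ] H := ∑ i ∈ range (n + 1), matUnit e i i

/-- The truncation to the span of `e 0, …, e n` of the backward shift. -/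
noncomputable def shift (n : ℕ) : H →L[ℂ] H := ∑ i ∈ range n, matUnit e i (i + 1)

theorem isSelfAdjoint_proj (n : ℕ) : IsSelfAdjoint (proj e n) := by
  simp [proj, IsSelfAdjoint, star_sum, star_matUnit]

section Orthonormal

variable {e} (he : Orthonormal ℂ e)
include he

omit [CompleteSpace H] in
theorem matUnit_apply (i j k : ℕ) : matUnit e i j (e k) = if j = k then e i else 0 := by
  rw [matUnit, rankOne_apply, orthonormal_iff_ite.mp he]
  split_ifs <;> simp

theorem matUnit_mul_matUnit (i j k l : ℕ) :
    matUnit e i j * matUnit e k l = if j = k then matUnit e i l else 0 := by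
  have : matUnit e i j * matUnit e k l = rankOne ℂ (matUnit e i j (e k)) (e l) :=
    InnerProductSpace.comp_rankOne ..
  rw [this, matUnit_apply he]
  split_ifs <;> simp [matUnit]

theorem proj_mul_matUnit (n i j : ℕ) :
    proj e n * matUnit e i j = if i ≤ n then matUnit e i j else 0 := by
  simp [proj, sum_mul, matUnit_mul_matUnit he]

theorem matUnit_mul_proj (n i j : ℕ) :
    matUnit e i j * proj e n = if j ≤ n then matUnit e i j else 0 := by
  simp [proj, mul_sum, matUnit_mul_matUnit he]

theorem proj_mul_proj {m n : ℕ} (h : m ≤ n) : proj e m * proj e n = proj e m := by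
  change (∑ i ∈ range (m + 1), matUnit e i i) * proj e n = ∑ i ∈ range (m + 1), matUnit e i i
  rw [sum_mul]
  refine sum_congr rfl fun i hi ↦ ?_
  rw [matUnit_mul_proj he, if_pos (by simp at hi; omega)]

theorem proj_mul_proj' {m n : ℕ} (h : m ≤ n) : proj e n * proj e m = proj e m := by
  have := congr(star $(proj_mul_proj he h))
  rwa [star_mul, (isSelfAdjoint_proj e _).star_eq, (isSelfAdjoint_proj e _).star_eq] at this

theorem isStarProjection_proj (n : ℕ) : IsStarProjection (proj e n) :=
  ⟨proj_mul_proj he le_rfl, isSelfAdjoint_proj e n⟩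

theorem proj_mul_shift_self (n : ℕ) : proj e n * shift e n = shift e n := by
  rw [shift, mul_sum]
  refine sum_congr rfl fun i hi ↦ ?_
  rw [proj_mul_matUnit he, if_pos (by simp at hi; omega)]

theorem shift_mul_proj {m n : ℕ} (h : m ≤ n) : shift e n * proj e m = shift e m := by
  simp only [shift, sum_mul, matUnit_mul_proj he]
  rw [← sum_filter]
  refine sum_congr ?_ fun _ _ ↦ rfl
  ext i
  simp
  omega

theorem proj_mul_shift {m n : ℕ} (h : m < n) : proj e m * shift e n = shift e (m + 1) := by
  simp only [shift, mul_sum, proj_mul_matUnit he]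
  rw [← sum_filter]
  refine sum_congr ?_ fun _ _ ↦ rfl
  ext i
  simp
  omega

theorem star_shift_mul_shift (n : ℕ) :
    star (shift e n) * shift e n + matUnit e 0 0 = proj e n := by
  rw [proj, sum_range_succ']
  congr 1
  simp only [shift, star_sum, star_matUnit, sum_mul, mul_sum, matUnit_mul_matUnit he]
  refine sum_congr rfl fun i hi ↦ ?_
  simp_all

omit [CompleteSpace H] in
theorem norm_matUnit (i j : ℕ) : ‖matUnit e i j‖ = 1 := by
  simp [matUnit, he.1]

theorem norm_shift_le (n : ℕ) : ‖shift e n‖ ≤ 2 := by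
  have h1 := (isStarProjection_proj he n).norm_le
  have h2 : ‖star (shift e n) * shift e n‖ ≤ 1 + 1 := by
    rw [eq_sub_of_add_eq (star_shift_mul_shift he n)]
    exact (norm_sub_le _ _).trans (add_le_add h1 (norm_matUnit he 0 0).le)
  rw [CStarRing.norm_star_mul_self] at h2
  nlinarith [norm_nonneg (shift e n)]

theorem proj_apply_of_le {i n : ℕ} (h : i ≤ n) : proj e n (e i) = e i := by
  have := congr($(proj_mul_matUnit he n i i) (e i))
  rw [if_pos h] at this
  simpa [matUnit_apply he] using this

theorem proj_apply_of_lt {i n : ℕ} (h : n < i) : proj e n (e i) = 0 := by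
  have := congr($(proj_mul_matUnit he n i i) (e i))
  rw [if_neg (by omega)] at this
  simpa [matUnit_apply he] using this

theorem star_shift_apply_self (n : ℕ) : star (shift e n) (e n) = 0 := by
  simp only [shift, star_sum, star_matUnit, _root_.sum_apply, matUnit_apply he]
  refine sum_eq_zero fun i hi ↦ if_neg ?_
  simp at hi
  omega

end Orthonormal

omit [CompleteSpace H] in
theorem proj_apply (n : ℕ) (x : H) : proj e n x = ∑ i ∈ range (n + 1), inner ℂ (e i) x • e i := by
  simp [proj, matUnit]

/-- The sequences of operators `f n` living on the span of `e 0, …, e n` which are constant from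
index `m` on. -/
def evConst (m : ℕ) : NonUnitalStarSubalgebra ℂ (ℕ →ᵇ (H →L[ℂ] H)) where
  carrier := {f | (∀ n, proj e n * f n = f n ∧ f n * proj e n = f n) ∧ ∀ n ≥ m, f n = f m}
  zero_mem' := by simp
  add_mem' := by
    rintro f g ⟨hf, hf'⟩ ⟨hg, hg'⟩
    refine ⟨fun n ↦ ?_, fun n hn ↦ ?_⟩
    · simp [mul_add, add_mul, hf n, hg n]
    · simp [hf' n hn, hg' n hn]
  mul_mem' := by
    rintro f g ⟨hf, hf'⟩ ⟨hg, hg'⟩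
    refine ⟨fun n ↦ ?_, fun n hn ↦ ?_⟩
    · simp only [BoundedContinuousFunction.mul_apply]
      rw [← mul_assoc, (hf n).1, mul_assoc, (hg n).2]
      exact ⟨rfl, rfl⟩
    · simp [hf' n hn, hg' n hn]
  smul_mem' := by
    rintro r f ⟨hf, hf'⟩
    refine ⟨fun n ↦ ?_, fun n hn ↦ ?_⟩
    · simp [hf n]
    · simp [hf' n hn]
  star_mem' := by
    rintro f ⟨hf, hf'⟩
    refine ⟨fun n ↦ ?_, fun n hn ↦ ?_⟩
    · have h1 := congr(star $((hf n).1))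
      have h2 := congr(star $((hf n).2))
      rw [star_mul, (isSelfAdjoint_proj e n).star_eq] at h1 h2
      exact ⟨h2, h1⟩
    · simp [hf' n hn]

theorem evConst_mono : Monotone (evConst e) := fun _ m' h _ hf ↦
  ⟨hf.1, fun n hn ↦ (hf.2 n (h.trans hn)).trans (hf.2 m' h).symm⟩

/-- The algebra of eventually constant sequences of operators `f n` living on the span of
`e 0, …, e n`. -/
def evConstAlg : NonUnitalStarSubalgebra ℂ (ℕ →ᵇ (H →L[ℂ] H)) where
  carrier := {f | ∃ m, f ∈ evConst e m}
  zero_mem' := ⟨0, zero_mem _⟩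
  add_mem' := by
    rintro f g ⟨m, hf⟩ ⟨n, hg⟩
    exact ⟨max m n, add_mem (evConst_mono e (le_max_left m n) hf)
      (evConst_mono e (le_max_right m n) hg)⟩
  mul_mem' := by
    rintro f g ⟨m, hf⟩ ⟨n, hg⟩
    exact ⟨max m n, mul_mem (evConst_mono e (le_max_left m n) hf)
      (evConst_mono e (le_max_right m n) hg)⟩
  smul_mem' := by
    rintro r f ⟨m, hf⟩
    exact ⟨m, (evConst e m).smul_mem r hf⟩
  star_mem' := by
    rintro f ⟨m, hf⟩
    exact ⟨m, star_mem hf⟩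

/-- The C⋆-algebra of sequences of operators `f n` living on the span of `e 0, …, e n` which
converge in norm. -/
noncomputable def convAlg : NonUnitalStarSubalgebra ℂ (ℕ →ᵇ (H →L[ℂ] H)) :=
  (evConstAlg e).topologicalClosure

instance : IsClosed (convAlg e : Set (ℕ →ᵇ (H →L[ℂ] H))) :=
  (evConstAlg e).isClosed_topologicalClosure

variable {e}

theorem evConst_le_convAlg (m : ℕ) : evConst e m ≤ convAlg e := fun _ hf ↦
  (evConstAlg e).le_topologicalClosure ⟨m, hf⟩

theorem exists_mem_evConst_norm_sub_lt {x : ℕ →ᵇ (H →L[ℂ] H)} (hx : x ∈ convAlg e) {ε : ℝ}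
    (hε : 0 < ε) : ∃ m, ∃ f ∈ evConst e m, ‖x - f‖ < ε := by
  obtain ⟨f, ⟨m, hf⟩, h⟩ := Metric.mem_closure_iff.mp hx ε hε
  exact ⟨m, f, hf, by rwa [← dist_eq_norm]⟩

theorem proj_mul_of_mem {x : ℕ →ᵇ (H →L[ℂ] H)} (hx : x ∈ convAlg e) (n : ℕ) :
    proj e n * x n = x n ∧ x n * proj e n = x n := by
  have hc : Continuous fun f : ℕ →ᵇ (H →L[ℂ] H) ↦ f n := continuous_eval_const n
  refine closure_minimal (t := {f | proj e n * f n = f n ∧ f n * proj e n = f n}) ?_ ?_ hx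
  · rintro f ⟨m, hf⟩
    exact hf.1 n
  · exact (isClosed_eq (by fun_prop) hc).inter (isClosed_eq (by fun_prop) hc)

/-- The truncated identity, an approximate unit of `convAlg e`. -/
noncomputable def approxUnit (he : Orthonormal ℂ e) (m : ℕ) : ℕ →ᵇ (H →L[ℂ] H) :=
  ofNormedAddCommGroupDiscrete (fun n ↦ proj e (min n m)) 1
    fun _ ↦ (isStarProjection_proj he _).norm_le

/-- The sequence of all truncations of the backward shift. -/
noncomputable def shiftSeq (he : Orthonormal ℂ e) : ℕ →ᵇ (H →L[ℂ] H) :=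
  ofNormedAddCommGroupDiscrete (shift e) 2 (norm_shift_le he)

theorem approxUnit_mem (he : Orthonormal ℂ e) (m : ℕ) : approxUnit he m ∈ evConst e m := by
  refine ⟨fun n ↦ ⟨proj_mul_proj' he (min_le_left _ _), proj_mul_proj he (min_le_left _ _)⟩,
    fun n hn ↦ ?_⟩
  simp [approxUnit, min_eq_right hn]

theorem isStarProjection_approxUnit (he : Orthonormal ℂ e) (m : ℕ) :
    IsStarProjection (approxUnit he m) := by
  refine ⟨?_, ?_⟩
  · ext1 n
    exact proj_mul_proj he le_rfl
  · refine BoundedContinuousFunction.ext fun n ↦ ?_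
    exact isSelfAdjoint_proj e _

theorem mul_approxUnit (he : Orthonormal ℂ e) {m : ℕ} {f : ℕ →ᵇ (H →L[ℂ] H)}
    (hf : f ∈ evConst e m) : f * approxUnit he m = f := by
  refine BoundedContinuousFunction.ext fun n ↦ ?_
  change f n * proj e (min n m) = f n
  rcases le_total n m with h | h
  · rw [min_eq_left h, (hf.1 n).2]
  · rw [min_eq_right h, hf.2 n h, (hf.1 m).2]

theorem exists_isStarProjection_norm_sub_mul_lt (he : Orthonormal ℂ e) (x : convAlg e) {ε : ℝ}
    (hε : 0 < ε) : ∃ u : convAlg e, IsStarProjection u ∧ ‖x - x * u‖ < ε := by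
  obtain ⟨m, f, hf, hxf⟩ := exists_mem_evConst_norm_sub_lt x.2 hε
  have hu := isStarProjection_approxUnit he m
  refine ⟨⟨approxUnit he m, evConst_le_convAlg m (approxUnit_mem he m)⟩,
    ⟨Subtype.ext hu.1, Subtype.ext hu.2⟩, ?_⟩
  have h2 : (x : ℕ →ᵇ (H →L[ℂ] H)) - x * approxUnit he m
      = (x - f) * (1 - approxUnit he m) := by
    simp only [sub_mul, mul_sub, mul_one, mul_approxUnit he hf]
    abel
  calc ‖(x : ℕ →ᵇ (H →L[ℂ] H)) - x * approxUnit he m‖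
      ≤ ‖(x : ℕ →ᵇ (H →L[ℂ] H)) - f‖ * 1 :=
        h2 ▸ norm_mul_le_of_le le_rfl hu.one_sub.norm_le
    _ < ε := by rwa [mul_one]

theorem shiftSeq_mul_mem (he : Orthonormal ℂ e) {x : ℕ →ᵇ (H →L[ℂ] H)} (hx : x ∈ convAlg e) :
    shiftSeq he * x ∈ convAlg e := by
  refine map_mem_closure (f := fun x ↦ shiftSeq he * x) (continuous_const_mul _) hx ?_
  rintro f ⟨m, hf⟩
  refine ⟨m, fun n ↦ ⟨?_, ?_⟩, fun n hn ↦ ?_⟩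
  · change proj e n * (shift e n * f n) = shift e n * f n
    rw [← mul_assoc, proj_mul_shift_self he]
  · change (shift e n * f n) * proj e n = shift e n * f n
    rw [mul_assoc, (hf.1 n).2]
  · change shift e n * f n = shift e m * f m
    rw [hf.2 n hn, ← (hf.1 m).1, ← mul_assoc, shift_mul_proj he hn, ← mul_assoc,
      shift_mul_proj he le_rfl]

theorem mul_shiftSeq_mem (he : Orthonormal ℂ e) {x : ℕ →ᵇ (H →L[ℂ] H)} (hx : x ∈ convAlg e) :
    x * shiftSeq he ∈ convAlg e := by
  refine map_mem_closure (f := fun x ↦ x * shiftSeq he) (continuous_mul_const _) hx ?_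
  rintro f ⟨m, hf⟩
  refine ⟨m + 1, fun n ↦ ⟨?_, ?_⟩, fun n hn ↦ ?_⟩
  · change proj e n * (f n * shift e n) = f n * shift e n
    rw [← mul_assoc, (hf.1 n).1]
  · change (f n * shift e n) * proj e n = f n * shift e n
    rw [mul_assoc, shift_mul_proj he le_rfl]
  · change f n * shift e n = f (m + 1) * shift e (m + 1)
    rw [hf.2 n (by omega), hf.2 (m + 1) (by omega), ← (hf.1 m).2, mul_assoc, mul_assoc,
      proj_mul_shift he (by omega), proj_mul_shift he (by omega)]

omit [CompleteSpace H] in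
theorem eq_zero_of_forall_inner_eq_zero {n : ℕ} {a : H →L[ℂ] H} (h1 : proj e n * a = a)
    (h2 : a * proj e n = a) (h : ∀ i ≤ n, ∀ j ≤ n, inner ℂ (e i) (a (e j)) = 0) : a = 0 := by
  have h3 : ∀ j ≤ n, a (e j) = 0 := fun j hj ↦ by
    rw [← h1, mul_apply_eq_comp, proj_apply]
    exact sum_eq_zero fun i hi ↦ by rw [h i (by simp at hi; omega) j hj, zero_smul]
  ext x
  rw [← h2, mul_apply_eq_comp, proj_apply, map_sum]
  exact sum_eq_zero fun i hi ↦ by rw [map_smul, h3 i (by simp at hi; omega), smul_zero]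

theorem finite_evConst (m : ℕ) : Module.Finite ℂ (evConst e m) := by
  let Φ : evConst e m →ₗ[ℂ] (Fin (m + 1) → Fin (m + 1) → Fin (m + 1) → ℂ) :=
    { toFun := fun f k i j ↦ inner ℂ (e i) ((f : ℕ →ᵇ (H →L[ℂ] H)) k (e j))
      map_add' := fun f g ↦ by ext; exact inner_add_right ..
      map_smul' := fun r f ↦ by ext; exact inner_smul_right .. }
  refine Module.Finite.of_injective Φ ((injective_iff_map_eq_zero Φ).mpr ?_)
  rintro ⟨f, hf⟩ h
  have h0 : ∀ k ≤ m, f k = 0 := fun k hk ↦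
    eq_zero_of_forall_inner_eq_zero (hf.1 k).1 (hf.1 k).2 fun i hi j hj ↦
      congr($h ⟨k, by omega⟩ ⟨i, by omega⟩ ⟨j, by omega⟩)
  refine Subtype.ext (BoundedContinuousFunction.ext fun k ↦ ?_)
  rcases le_total k m with hk | hk
  · exact h0 k hk
  · exact (hf.2 k hk).trans (h0 m le_rfl)

/-- The sequence with entry `a` at index `n` and zero elsewhere. -/
noncomputable def single (n : ℕ) (a : H →L[ℂ] H) : ℕ →ᵇ (H →L[ℂ] H) :=
  ofNormedAddCommGroupDiscrete (fun k ↦ if k = n then a else 0) ‖a‖ fun k ↦ by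
    split_ifs <;> simp

omit [CompleteSpace H] in
theorem single_apply_self (n : ℕ) (a : H →L[ℂ] H) : single n a n = a := if_pos rfl

theorem single_mem {n : ℕ} {a : H →L[ℂ] H} (h1 : proj e n * a = a) (h2 : a * proj e n = a) :
    single n a ∈ convAlg e := by
  refine evConst_le_convAlg (n + 1) ⟨fun k ↦ ?_, fun k hk ↦ ?_⟩
  · by_cases hk : k = n
    · subst hk
      rw [single_apply_self]
      exact ⟨h1, h2⟩
    · simp [single, hk]
  · simp [single, show k ≠ n by omega]

theorem const_matUnit_mem (he : Orthonormal ℂ e) :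
    const ℕ (matUnit e 0 0) ∈ convAlg e :=
  evConst_le_convAlg 0 ⟨fun n ↦ ⟨(proj_mul_matUnit he n 0 0).trans (if_pos n.zero_le),
    (matUnit_mul_proj he n 0 0).trans (if_pos n.zero_le)⟩, fun _ _ ↦ rfl⟩

theorem star_shiftSeq_mul_add_const_mul (he : Orthonormal ℂ e) {x : ℕ →ᵇ (H →L[ℂ] H)}
    (hx : x ∈ convAlg e) :
    (star (shiftSeq he) * shiftSeq he + const ℕ (matUnit e 0 0)) * x = x ∧
      x * (star (shiftSeq he) * shiftSeq he + const ℕ (matUnit e 0 0)) = x := by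
  refine ⟨BoundedContinuousFunction.ext fun n ↦ ?_, BoundedContinuousFunction.ext fun n ↦ ?_⟩
  · change (star (shift e n) * shift e n + matUnit e 0 0) * x n = x n
    rw [star_shift_mul_shift he, (proj_mul_of_mem hx n).1]
  · change x n * (star (shift e n) * shift e n + matUnit e 0 0) = x n
    rw [star_shift_mul_shift he, (proj_mul_of_mem hx n).2]

omit [CompleteSpace H] in
theorem eq_zero_or_eq_zero_of_mul_rankOne_mul {D D' : H →L[ℂ] H}
    (h : ∀ ξ η, D' * rankOne ℂ ξ η * D = 0) : D' = 0 ∨ D = 0 := by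
  by_contra! hne
  obtain ⟨⟨ξ, hξ⟩, ⟨η, hη⟩⟩ : (∃ ξ, D' ξ ≠ 0) ∧ ∃ η, D η ≠ 0 := by
    simpa [ContinuousLinearMap.ext_iff] using hne
  have := congr($(h ξ (D η)) η)
  simp [hξ, hη] at this

theorem mul_star_eq_proj_or_star_mul_eq_proj (he : Orthonormal ℂ e) {n : ℕ} {b : H →L[ℂ] H}
    (h1 : proj e n * b = b) (h2 : b * proj e n = b)
    (h : ∀ x, proj e n * x = x → x * proj e n = x →
      (1 - b * star b) * x * (1 - star b * b) * proj e n = 0) :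
    b * star b = proj e n ∨ star b * b = proj e n := by
  have hP := proj_mul_proj he (le_refl n)
  have hPs := (isSelfAdjoint_proj e n).star_eq
  have h1s : star b * proj e n = star b := by simpa [hPs] using congr(star $h1)
  have h2s : proj e n * star b = star b := by simpa [hPs] using congr(star $h2)
  have key : ∀ ξ η, (proj e n - b * star b) * rankOne ℂ ξ η * (proj e n - star b * b) = 0 := by
    intro ξ η
    have h3 := h (proj e n * rankOne ℂ ξ η * proj e n)
      (by rw [← mul_assoc, ← mul_assoc, hP]) (by rw [mul_assoc, hP])
    have c1 : proj e n - b * star b = (1 - b * star b) * proj e n := by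
      rw [sub_mul, one_mul, mul_assoc, h1s]
    have c2 : proj e n - star b * b = proj e n * ((1 - star b * b) * proj e n) := by
      rw [sub_mul, one_mul, mul_assoc, h2, mul_sub, hP, ← mul_assoc, h2s]
    rw [c1, c2, ← h3]
    simp only [mul_assoc]
  rcases eq_zero_or_eq_zero_of_mul_rankOne_mul key with h | h
  · exact .inl (sub_eq_zero.mp h).symm
  · exact .inr (sub_eq_zero.mp h).symm

theorem norm_le_one_of_mul_star_eq_proj (he : Orthonormal ℂ e) {n : ℕ} {b : H →L[ℂ] H}
    (h : b * star b = proj e n) : ‖b‖ ≤ 1 := by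
  have := (isStarProjection_proj he n).norm_le
  rw [← h, CStarRing.norm_self_mul_star] at this
  nlinarith [norm_nonneg b]

/-- A perturbation of `shift e n` by an operator living on the span of `e 0, …, e m` is far from
being a coisometry of the span of `e 0, …, e n`. -/
theorem mul_star_ne_proj (he : Orthonormal ℂ e) {m n : ℕ} (hmn : m < n) {b f : H →L[ℂ] H}
    (hf : proj e m * f = f) (hb : ‖b - (shift e n + f)‖ < 1) : b * star b ≠ proj e n := by
  intro h
  have hb1 := norm_le_one_of_mul_star_eq_proj he h
  have hf' : star f (e n) = 0 := by
    have : star f * proj e m = star f := by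
      simpa [(isSelfAdjoint_proj e m).star_eq] using congr(star $hf)
    rw [← this, mul_apply_eq_comp, proj_apply_of_lt he hmn, map_zero]
  have h1 : star b (e n) = star (b - (shift e n + f)) (e n) := by
    simp [star_shift_apply_self he, hf']
  have h2 : b (star b (e n)) = e n := by
    rw [← mul_apply_eq_comp, h, proj_apply_of_le he le_rfl]
  have h3 : ‖b (star b (e n))‖ < 1 := by
    calc _ ≤ 1 * ‖star b (e n)‖ := b.le_of_opNorm_le hb1 _
      _ ≤ 1 * (‖star (b - (shift e n + f))‖ * ‖e n‖) := by
        rw [h1]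
        gcongr
        exact ContinuousLinearMap.le_opNorm _ _
      _ < 1 := by rwa [he.1, one_mul, mul_one, norm_star]
  rw [h2, he.1] at h3
  exact lt_irrefl _ h3

/-- A map from the span of `e 0, …, e (m + 1)` to the span of `e 0, …, e m` has a kernel. -/
theorem exists_ne_zero_apply_eq_zero (he : Orthonormal ℂ e) {m : ℕ} {b : H →L[ℂ] H}
    (hb : proj e m * b * proj e (m + 1) = b * proj e (m + 1)) :
    ∃ ξ ≠ 0, proj e (m + 1) ξ = ξ ∧ b ξ = 0 := by
  let Φ : (Fin (m + 2) → ℂ) →ₗ[ℂ] H := Fintype.linearCombination ℂ fun j : Fin (m + 2) ↦ e j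
  let Ψ : (Fin (m + 2) → ℂ) →ₗ[ℂ] (Fin (m + 1) → ℂ) :=
    LinearMap.pi fun i ↦ (innerₛₗ ℂ (e i)).comp (b.toLinearMap.comp Φ)
  have hker : LinearMap.ker Ψ ≠ ⊥ := LinearMap.ker_ne_bot_of_finrank_lt (by simp)
  obtain ⟨c, hc, hc0⟩ := Submodule.exists_mem_ne_zero_of_ne_bot hker
  have hli : LinearIndependent ℂ fun j : Fin (m + 2) ↦ e j :=
    (he.comp _ Fin.val_injective).linearIndependent
  have hproj : proj e (m + 1) (Φ c) = Φ c := by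
    simp only [Φ, Fintype.linearCombination_apply, map_sum, map_smul]
    exact sum_congr rfl fun j _ ↦ by rw [proj_apply_of_le he (by omega)]
  refine ⟨Φ c, fun h ↦ hc0 ?_, hproj, ?_⟩
  · exact hli.fintypeLinearCombination_injective (h.trans (map_zero _).symm)
  · have h1 := congr($hb (Φ c))
    simp only [mul_apply_eq_comp, hproj] at h1
    rw [← h1, proj_apply]
    refine sum_eq_zero fun i hi ↦ ?_
    have h2 : inner ℂ (e i) (b (Φ c)) = 0 := congr($hc ⟨i, by simpa using hi⟩)
    rw [h2, zero_smul]

/-- A perturbation of `shift e (m + 1)` by an operator living on the span of `e 0, …, e m` is far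
from being an isometry of the span of `e 0, …, e (m + 1)`. -/
theorem star_mul_ne_proj (he : Orthonormal ℂ e) {m : ℕ} {b f : H →L[ℂ] H}
    (hf : proj e m * f = f) (hb : ‖b - (shift e (m + 1) + f)‖ < 1) :
    star b * b ≠ proj e (m + 1) := by
  intro h
  have hb1 : ‖star b‖ ≤ 1 := norm_le_one_of_mul_star_eq_proj he (by rwa [star_star])
  obtain ⟨ξ, hξ0, hξ, hbξ⟩ := exists_ne_zero_apply_eq_zero he (b := shift e (m + 1) + f) (m := m)
    (by rw [mul_add, hf, proj_mul_shift he m.lt_succ_self])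
  have h1 : b ξ = (b - (shift e (m + 1) + f)) ξ := by
    rw [_root_.sub_apply, hbξ, sub_zero]
  have h2 : star b (b ξ) = ξ := by
    rw [← mul_apply_eq_comp, h, hξ]
  have h3 : ‖star b (b ξ)‖ < ‖ξ‖ := by
    calc _ ≤ 1 * ‖b ξ‖ := (star b).le_of_opNorm_le hb1 _
      _ ≤ 1 * (‖b - (shift e (m + 1) + f)‖ * ‖ξ‖) := by
        rw [h1]
        gcongr
        exact ContinuousLinearMap.le_opNorm _ _
      _ < ‖ξ‖ := by
        rw [one_mul]
        exact mul_lt_of_lt_one_left (norm_pos_iff.mpr hξ0) hb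
  rw [h2] at h3
  exact lt_irrefl _ h3

theorem exists_defect_mul_mul_defect_mul_ne_zero (he : Orthonormal ℂ e) {a : ℕ →ᵇ (H →L[ℂ] H)}
    (ha : a - shiftSeq he ∈ convAlg e) : ∃ x ∈ convAlg e, ∃ y ∈ convAlg e,
      (1 - a * star a) * x * (1 - star a * a) * y ≠ 0 := by
  obtain ⟨m, f, hf, haf⟩ := exists_mem_evConst_norm_sub_lt ha one_pos
  have hP := proj_mul_proj he (le_refl (m + 1))
  by_contra! h
  obtain ⟨h1, h2⟩ := proj_mul_of_mem ha (m + 1)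
  rw [show (a - shiftSeq he) (m + 1) = a (m + 1) - shift e (m + 1) from rfl] at h1 h2
  rw [mul_sub, proj_mul_shift_self he, sub_left_inj] at h1
  rw [sub_mul, shift_mul_proj he le_rfl, sub_left_inj] at h2
  have hb : ‖a (m + 1) - (shift e (m + 1) + f m)‖ < 1 := by
    rw [← sub_sub, ← hf.2 (m + 1) (by omega)]
    exact ((a - shiftSeq he - f).norm_coe_le_norm (m + 1)).trans_lt haf
  refine (mul_star_eq_proj_or_star_mul_eq_proj he h1 h2 fun x hx1 hx2 ↦ ?_).elim
    (mul_star_ne_proj he m.lt_succ_self (hf.1 m).1 hb) (star_mul_ne_proj he (hf.1 m).1 hb)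
  have h3 := congr($(h _ (single_mem hx1 hx2) _ (single_mem hP hP)) (m + 1))
  have h4 := single_apply_self (m + 1) x
  have h5 := single_apply_self (m + 1) (proj e (m + 1))
  simpa [h4, h5] using h3

end ShiftExample

open ShiftExample in
/-- There exists a C*-algebra `I` of stable rank one and an isometry `v`
(hence an extreme point of the closed unit ball) in the corona algebra `C(I) = 𝓜(ℂ, I)/I`
such that no extreme point of the closed unit ball of `𝓜(ℂ, I)` is mapped to `v` by the
quotient map. -/
theorem stmt18 : Nonempty Stmt18Witness := by
  let b : HilbertBasis ℕ ℂ (lp (fun _ : ℕ ↦ ℂ) 2) := default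
  have he := b.orthonormal
  refine nonempty_stmt18Witness (I := convAlg b) ?_
    (fun x _ ↦ exists_isStarProjection_norm_sub_mul_lt he x) (fun _ ↦ shiftSeq_mul_mem he)
    (fun _ ↦ mul_shiftSeq_mem he) (const_matUnit_mem he)
    (fun _ ↦ star_shiftSeq_mul_add_const_mul he)
    fun _ ↦ exists_defect_mul_mul_defect_mul_ne_zero he
  refine NonUnitalStarSubalgebra.dense_isUnit_unitization fun x hx ε hε ↦ ?_
  obtain ⟨m, f, hf, h⟩ := exists_mem_evConst_norm_sub_lt hx hε
  exact ⟨evConst b m, evConst_le_convAlg m, finite_evConst m, f, hf, h⟩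
end
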